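/- arXiv:dg-ga/9502008 — 2 statements merged into one kernel-verified Lean document; each statement's English description precedes it below -/
import Mathlib

section
/- Classification of Poisson subalgebras above P¹: the only Poisson subalgebras C of P with P¹ ⊆ C are C = P¹, C = Õ, and C = P. -/
open MvPolynomial MeasureTheory

noncomputable section

attribute [local instance] Classical.propDecidable

/-- The Poisson bracket on `ℝ[X₀,X₁,X₂]` associated to the sphere:
`{f,g} = Σ εᵢⱼₖ Xᵢ ∂f/∂Xⱼ ∂g/∂Xₖ` (indices `0,1,2` play the role of `1,2,3`). -/
def pb (f g : MvPolynomial (Fin 3) ℝ) : MvPolynomial (Fin 3) ℝ :=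
  X 0 * (pderiv 1 f * pderiv 2 g - pderiv 2 f * pderiv 1 g) +
  X 1 * (pderiv 2 f * pderiv 0 g - pderiv 0 f * pderiv 2 g) +
  X 2 * (pderiv 0 f * pderiv 1 g - pderiv 1 f * pderiv 0 g)

/-- The ideal generated by `X₀² + X₁² + X₂² - s²`. -/
def sphereIdeal (s : ℝ) : Ideal (MvPolynomial (Fin 3) ℝ) :=
  Ideal.span {X 0 ^ 2 + X 1 ^ 2 + X 2 ^ 2 - C (s ^ 2)}

/-- The Poisson algebra `P` of polynomial functions on the sphere of radius `s`. -/
abbrev SpherePoly (s : ℝ) := MvPolynomial (Fin 3) ℝ ⧸ sphereIdeal s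

/-- The quotient map `ℝ[X₀,X₁,X₂] → P`. -/
def toSphere (s : ℝ) : MvPolynomial (Fin 3) ℝ →+* SpherePoly s :=
  Ideal.Quotient.mk (sphereIdeal s)

/-- The components `S₁, S₂, S₃` of the spin vector (indexed by `Fin 3`). -/
def S (s : ℝ) (i : Fin 3) : SpherePoly s := toSphere s (X i)

/-- A choice of polynomial representative of an element of `P`. -/
def rep (s : ℝ) (p : SpherePoly s) : MvPolynomial (Fin 3) ℝ :=
  (Ideal.Quotient.mk_surjective (I := sphereIdeal s) p).choose

/-- The Poisson bracket descended to `P`.  (It is independent of the choice of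
representatives, since the bracket of any polynomial with the generator
`X₀² + X₁² + X₂² - s²` vanishes identically.) -/
def pbS (s : ℝ) (p q : SpherePoly s) : SpherePoly s :=
  toSphere s (pb (rep s p) (rep s q))

/-- `P¹`, the ℝ-linear span of `{1, S₁, S₂, S₃}` in `P`. -/
def P1 (s : ℝ) : Submodule ℝ (SpherePoly s) :=
  Submodule.span ℝ ({1, S s 0, S s 1, S s 2} : Set (SpherePoly s))

theorem one_mem_P1 (s : ℝ) : (1 : SpherePoly s) ∈ P1 s :=
  Submodule.subset_span (Set.mem_insert _ _)

theorem S_mem_P1 (s : ℝ) (i : Fin 3) : S s i ∈ P1 s := by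
  apply Submodule.subset_span
  fin_cases i <;> simp

/-- The Laplacian on `ℝ[X₀,X₁,X₂]` as a linear map. -/
def laplacian : MvPolynomial (Fin 3) ℝ →ₗ[ℝ] MvPolynomial (Fin 3) ℝ :=
  (pderiv 0).toLinearMap ∘ₗ (pderiv 0).toLinearMap +
  (pderiv 1).toLinearMap ∘ₗ (pderiv 1).toLinearMap +
  (pderiv 2).toLinearMap ∘ₗ (pderiv 2).toLinearMap

/-- Homogeneous harmonic polynomials of degree `l`. -/
def harmonicHomog (l : ℕ) : Submodule ℝ (MvPolynomial (Fin 3) ℝ) :=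
  homogeneousSubmodule (Fin 3) ℝ l ⊓ LinearMap.ker laplacian

/-- `H_l`, the image in `P` of the homogeneous harmonic polynomials of degree `l`. -/
def Hsph (s : ℝ) (l : ℕ) : Submodule ℝ (SpherePoly s) :=
  (harmonicHomog l).map (Ideal.Quotient.mkₐ ℝ (sphereIdeal s)).toLinearMap

/-- `O`, the odd polynomials: the sum of the `H_l` over odd `l`. -/
def Osph (s : ℝ) : Submodule ℝ (SpherePoly s) :=
  ⨆ (l : ℕ) (_ : Odd l), Hsph s l

/-- `Õ = ℝ·1 ⊕ O`. -/
def Otilde (s : ℝ) : Submodule ℝ (SpherePoly s) :=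
  Submodule.span ℝ ({1} : Set (SpherePoly s)) ⊔ Osph s

theorem S_mem_H1 (s : ℝ) (i : Fin 3) : S s i ∈ Hsph s 1 := by
  refine ⟨X i, ⟨isHomogeneous_X _ _, ?_⟩, rfl⟩
  fin_cases i <;> simp [laplacian, pderiv_X]

theorem S_mem_Otilde (s : ℝ) (i : Fin 3) : S s i ∈ Otilde s :=
  Submodule.mem_sup_right
    ((le_iSup₂ (f := fun (l : ℕ) (_ : Odd l) => Hsph s l) 1 odd_one) (S_mem_H1 s i))

theorem one_mem_Otilde (s : ℝ) : (1 : SpherePoly s) ∈ Otilde s :=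
  Submodule.mem_sup_left (Submodule.mem_span_singleton_self 1)

namespace SpherePoisson

/-- The Hamiltonian derivation `{f, ·}` on `K[X₀,X₁,X₂]`. -/
def ham {K : Type*} [CommRing K] (f : MvPolynomial (Fin 3) K) :
    Derivation K (MvPolynomial (Fin 3) K) (MvPolynomial (Fin 3) K) :=
  (X 1 * pderiv 2 f - X 2 * pderiv 1 f) • pderiv 0 +
  (X 2 * pderiv 0 f - X 0 * pderiv 2 f) • pderiv 1 +
  (X 0 * pderiv 1 f - X 1 * pderiv 0 f) • pderiv 2

theorem ham_apply {K : Type*} [CommRing K] (f g : MvPolynomial (Fin 3) K) :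
    ham f g = (X 1 * pderiv 2 f - X 2 * pderiv 1 f) * pderiv 0 g +
      (X 2 * pderiv 0 f - X 0 * pderiv 2 f) * pderiv 1 g +
      (X 0 * pderiv 1 f - X 1 * pderiv 0 f) * pderiv 2 g := rfl

theorem pb_eq_ham (f g : MvPolynomial (Fin 3) ℝ) : pb f g = ham f g := by
  rw [ham_apply, pb]; ring

theorem ham_antisymm {K : Type*} [CommRing K] (f g : MvPolynomial (Fin 3) K) :
    ham f g = -ham g f := by
  simp only [ham_apply]; ring

/-- The inclusion of real polynomials into complex polynomials. -/
abbrev toComplex : MvPolynomial (Fin 3) ℝ →+* MvPolynomial (Fin 3) ℂ := map (algebraMap ℝ ℂ)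

theorem toComplex_ham (f g : MvPolynomial (Fin 3) ℝ) :
    toComplex (ham f g) = ham (toComplex f) (toComplex g) := by
  simp [ham_apply, pderiv_map]

/-! ### The `sl₂`-triple acting on complex polynomials -/

/-- The highest weight coordinate `X₀ + i X₁`. -/
def U : MvPolynomial (Fin 3) ℂ := X 0 + C Complex.I * X 1

/-- The lowest weight coordinate `X₀ - i X₁`. -/
def V : MvPolynomial (Fin 3) ℂ := X 0 - C Complex.I * X 1

/-- The raising operator. -/
def raise : Derivation ℂ (MvPolynomial (Fin 3) ℂ) (MvPolynomial (Fin 3) ℂ) :=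
  Complex.I • ham U

/-- The lowering operator. -/
def lower : Derivation ℂ (MvPolynomial (Fin 3) ℂ) (MvPolynomial (Fin 3) ℂ) :=
  Complex.I • ham V

/-- The weight operator. -/
def cartan : Derivation ℂ (MvPolynomial (Fin 3) ℂ) (MvPolynomial (Fin 3) ℂ) :=
  (2 * Complex.I) • ham (X 2)

theorem C_I_sq : (C Complex.I : MvPolynomial (Fin 3) ℂ) ^ 2 = -1 := by
  rw [← C_pow, Complex.I_sq]; simp

theorem C_two : (C 2 : MvPolynomial (Fin 3) ℂ) = 2 := map_ofNat C 2

theorem C_three : (C 3 : MvPolynomial (Fin 3) ℂ) = 3 := map_ofNat C 3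

theorem C_four : (C 4 : MvPolynomial (Fin 3) ℂ) = 4 := map_ofNat C 4

theorem C_six : (C 6 : MvPolynomial (Fin 3) ℂ) = 6 := map_ofNat C 6

theorem derivation_two {K A : Type*} [CommRing K] [CommRing A] [Algebra K A]
    (D : Derivation K A A) : D 2 = 0 := by
  exact_mod_cast D.map_natCast 2

theorem raise_U : raise U = 0 := by
  simp [raise, ham_apply, smul_eq_C_mul]
  ring

theorem raise_V : raise V = 2 * X 2 := by
  simp [raise, ham_apply, smul_eq_C_mul, U, V, pderiv_X]
  linear_combination (-2 * X 2) * C_I_sq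

theorem raise_Z : raise (X 2) = -U := by
  simp [raise, ham_apply, smul_eq_C_mul, U, pderiv_X]
  linear_combination (X 0) * C_I_sq

theorem lower_U : lower U = -(2 * X 2) := by
  simp [lower, ham_apply, smul_eq_C_mul, U, V, pderiv_X]
  linear_combination (2 * X 2) * C_I_sq

theorem lower_V : lower V = 0 := by
  simp [lower, ham_apply, smul_eq_C_mul]
  ring

theorem lower_Z : lower (X 2) = V := by
  simp [lower, ham_apply, smul_eq_C_mul, V, pderiv_X]
  linear_combination (-X 0) * C_I_sq

theorem cartan_U : cartan U = 2 * U := by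
  simp [cartan, ham_apply, smul_eq_C_mul, U, pderiv_X, C_two]
  linear_combination (-2 * X 0) * C_I_sq

theorem raise_lower (f : MvPolynomial (Fin 3) ℂ) :
    raise (lower f) = lower (raise f) + cartan f := by
  have : ⁅raise, lower⁆ = cartan := by
    refine derivation_ext fun i => ?_
    rw [Derivation.commutator_apply]
    fin_cases i <;> simp [raise, lower, cartan, ham_apply, smul_eq_C_mul, U, V, pderiv_X, C_two]
    · linear_combination (-2 * C Complex.I * X 1) * C_I_sq
    · linear_combination (2 * C Complex.I * X 0) * C_I_sq
  rw [← this, Derivation.commutator_apply]; ring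

theorem cartan_lower (f : MvPolynomial (Fin 3) ℂ) :
    cartan (lower f) = lower (cartan f) - 2 * lower f := by
  have : ⁅cartan, lower⁆ = (-2 : ℂ) • lower := by
    refine derivation_ext fun i => ?_
    rw [Derivation.commutator_apply]
    fin_cases i <;> simp [lower, cartan, ham_apply, smul_eq_C_mul, V, pderiv_X, C_two,
      derivation_two]
    · ring
    · linear_combination (2 * C Complex.I * X 2) * C_I_sq
    · linear_combination (-2 * C Complex.I * X 1) * C_I_sq
  have h2 := DFunLike.congr_fun this f
  simp [Derivation.commutator_apply, smul_eq_C_mul, C_two] at h2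
  linear_combination h2

/-- The weight vectors `lower^k (U^l)`. -/
def weightVec (l k : ℕ) : MvPolynomial (Fin 3) ℂ := (⇑lower)^[k] (U ^ l)

@[simp] theorem weightVec_zero (l : ℕ) : weightVec l 0 = U ^ l := rfl

theorem lower_weightVec (l k : ℕ) : lower (weightVec l k) = weightVec l (k + 1) :=
  (Function.iterate_succ_apply' _ _ _).symm

theorem raise_U_pow (l : ℕ) : raise (U ^ l) = 0 := by
  simp [Derivation.leibniz_pow, raise_U]

theorem cartan_U_pow (l : ℕ) : cartan (U ^ l) = (2 * l : ℂ) • U ^ l := by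
  cases l with
  | zero => simp
  | succ l =>
    simp [Derivation.leibniz_pow, cartan_U, smul_eq_C_mul, C_two]
    ring

theorem cartan_weightVec (l k : ℕ) :
    cartan (weightVec l k) = (2 * l - 2 * k : ℂ) • weightVec l k := by
  induction k with
  | zero =>
    rw [weightVec_zero, cartan_U_pow]
    simp
  | succ k ih =>
    rw [← lower_weightVec, cartan_lower, ih, Derivation.map_smul]
    simp only [smul_eq_C_mul, Nat.cast_add, Nat.cast_one, map_sub, map_mul, map_add, C_two, map_one]
    ring

theorem raise_weightVec_succ (l k : ℕ) :
    raise (weightVec l (k + 1)) = ((k + 1) * (2 * l - k) : ℂ) • weightVec l k := by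
  induction k with
  | zero =>
    rw [← lower_weightVec, raise_lower, cartan_weightVec, weightVec_zero, raise_U_pow]
    simp
  | succ k ih =>
    rw [← lower_weightVec, raise_lower, cartan_weightVec, ih, Derivation.map_smul, lower_weightVec,
      ← add_smul]
    congr 1
    push_cast
    ring

theorem iterate_lower_mul_eq_zero (n : ℕ) : ∀ (a b : ℕ) (f g : MvPolynomial (Fin 3) ℂ),
    a + b = n → (⇑lower)^[a + 1] f = 0 → (⇑lower)^[b + 1] g = 0 →
    (⇑lower)^[n + 1] (f * g) = 0 := by
  have hz : ∀ m, (⇑lower)^[m] 0 = 0 := fun m => iterate_map_zero lower m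
  induction n with
  | zero =>
    intro a b f g hab hf hg
    obtain ⟨rfl, rfl⟩ : a = 0 ∧ b = 0 := by omega
    simp at hf hg
    simp [hf, hg]
  | succ n ih =>
    intro a b f g hab hf hg
    rw [Function.iterate_succ_apply, Derivation.leibniz, iterate_map_add]
    simp only [smul_eq_mul]
    have h1 : (⇑lower)^[n + 1] (f * lower g) = 0 := by
      cases b with
      | zero => simp at hg; simp only [hg, mul_zero, hz]
      | succ b => exact ih a b _ _ (by omega) hf (by rwa [← Function.iterate_succ_apply])
    have h2 : (⇑lower)^[n + 1] (g * lower f) = 0 := by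
      cases a with
      | zero => simp at hf; simp only [hf, mul_zero, hz]
      | succ a =>
        exact ih b a _ _ (by omega) hg (by rwa [← Function.iterate_succ_apply])
    rw [h1, h2, add_zero]

theorem weightVec_two_mul_succ (l : ℕ) : weightVec l (2 * l + 1) = 0 := by
  induction l with
  | zero => simp [weightVec]
  | succ l ih =>
    rw [weightVec, pow_succ]
    refine iterate_lower_mul_eq_zero (2 * (l + 1)) (2 * l) 2 _ _ (by ring) ih ?_
    simp [Function.iterate_succ_apply, lower_U, lower_Z, lower_V, Derivation.leibniz,
      derivation_two]

/-- An operator having the weight vectors as eigenvectors with distinct eigenvalues. -/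
def sepOp : Module.End ℂ (MvPolynomial (Fin 3) ℂ) :=
  (lower : MvPolynomial (Fin 3) ℂ →ₗ[ℂ] MvPolynomial (Fin 3) ℂ) ∘ₗ
    (raise : MvPolynomial (Fin 3) ℂ →ₗ[ℂ] MvPolynomial (Fin 3) ℂ) +
  Complex.I • (cartan : MvPolynomial (Fin 3) ℂ →ₗ[ℂ] MvPolynomial (Fin 3) ℂ)

theorem sepOp_apply (f : MvPolynomial (Fin 3) ℂ) :
    sepOp f = lower (raise f) + Complex.I • cartan f := rfl

/-- The eigenvalue of `sepOp` on `weightVec l k`. -/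
def sepVal (x : ℕ × ℕ) : ℂ :=
  x.2 * (2 * x.1 - x.2 + 1) + Complex.I * (2 * x.1 - 2 * x.2)

theorem sepOp_weightVec (l k : ℕ) :
    sepOp (weightVec l k) = sepVal (l, k) • weightVec l k := by
  rw [sepOp_apply, cartan_weightVec, smul_smul, sepVal, add_smul]
  congr 1
  cases k with
  | zero =>
    rw [weightVec_zero, raise_U_pow]
    simp
  | succ k =>
    rw [raise_weightVec_succ, Derivation.map_smul, lower_weightVec]
    congr 1
    push_cast
    ring

theorem sepVal_injOn : Set.InjOn sepVal {x | x.2 ≤ 2 * x.1} := by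
  rintro ⟨l, k⟩ hk ⟨l', k'⟩ hk' h
  simp only [Set.mem_ofPred_eq] at hk hk'
  have hre := congrArg Complex.re h
  have him := congrArg Complex.im h
  simp [sepVal] at hre him
  have h1 : (l : ℝ) = l' - k' + k := by linarith
  have h2 : ((k : ℝ) - k') * (l + l' + 1) = 0 := by
    rw [h1] at hre ⊢
    linear_combination hre
  have h3 : (l : ℝ) + l' + 1 ≠ 0 := by positivity
  have h4 : (k : ℝ) = k' := by
    rcases mul_eq_zero.1 h2 with h | h
    · linarith
    · exact absurd h h3
  have h5 : (l : ℝ) = l' := by linarith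
  simp only [Prod.mk.injEq]
  exact ⟨by exact_mod_cast h5, by exact_mod_cast h4⟩

/-- A subspace invariant under `T` contains each term of a sum of eigenvectors with distinct
eigenvalues as soon as it contains the sum. -/
theorem mem_of_sum_eigenvectors_mem {K M ι : Type*} [Field K] [AddCommGroup M] [Module K M]
    (T : Module.End K M) (W : Submodule K M) (hW : ∀ w ∈ W, T w ∈ W) (μ : ι → K)
    (t : Finset ι) : ∀ v : ι → M, (∀ i ∈ t, T (v i) = μ i • v i) → Set.InjOn μ t →
      ∑ i ∈ t, v i ∈ W → ∀ i ∈ t, v i ∈ W := by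
  induction t using Finset.induction_on with
  | empty => simp
  | insert a t ha ih =>
    intro v hv hμ hsum
    have key : ∀ i ∈ t, v i ∈ W := by
      intro i hi
      have h1 : ∑ j ∈ t, (μ j - μ a) • v j ∈ W := by
        have h2 := W.sub_mem (hW _ hsum) (W.smul_mem (μ a) hsum)
        rw [map_sum, Finset.smul_sum, ← Finset.sum_sub_distrib, Finset.sum_insert ha,
          hv a (Finset.mem_insert_self _ _), sub_self, zero_add] at h2
        convert h2 using 1
        refine Finset.sum_congr rfl fun j hj => ?_
        rw [hv j (Finset.mem_insert_of_mem hj), sub_smul]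
      have h3 := ih (fun j => (μ j - μ a) • v j)
        (fun j hj => by
          rw [map_smul, hv j (Finset.mem_insert_of_mem hj), smul_comm])
        (hμ.mono (by simp)) h1 i hi
      refine (W.smul_mem_iff (sub_ne_zero.2 fun h => ha ?_)).1 h3
      rw [← hμ (Finset.mem_coe.2 (Finset.mem_insert_of_mem hi))
        (Finset.mem_coe.2 (Finset.mem_insert_self _ _)) h]
      exact hi
    intro i hi
    rcases Finset.mem_insert.1 hi with rfl | hi
    · rw [Finset.sum_insert ha] at hsum
      exact (W.add_mem_iff_left (W.sum_mem key)).1 hsum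
    · exact key i hi

/-! ### Lowering-invariant subspaces containing powers of `U` -/

/-- The defining relation of the sphere in complex coordinates. -/
def relation (s : ℝ) : MvPolynomial (Fin 3) ℂ :=
  X 0 ^ 2 + X 1 ^ 2 + X 2 ^ 2 - C ((s : ℂ) ^ 2)

theorem relation_eq (s : ℝ) : relation s = U * V + X 2 ^ 2 - C ((s : ℂ) ^ 2) := by
  rw [relation, U, V]
  linear_combination (X 1 ^ 2) * C_I_sq

theorem UVZ_mem (s : ℝ) (D : Submodule ℂ (MvPolynomial (Fin 3) ℂ))
    (hrel : ∀ f, f * relation s ∈ D) (hlow : ∀ f ∈ D, lower f ∈ D) (N : ℕ) :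
    (∀ n ≤ N, n % 2 = N % 2 → U ^ n ∈ D) →
      ∀ a b c : ℕ, a + b + c = N → X 2 ^ a * U ^ b * V ^ c ∈ D := by
  induction N using Nat.strong_induction_on with
  | _ N ih =>
  intro hU
  have red : ∀ a b c : ℕ, a + (b + 1) + (c + 1) = N → X 2 ^ (a + 2) * U ^ b * V ^ c ∈ D →
      X 2 ^ a * U ^ (b + 1) * V ^ (c + 1) ∈ D := by
    intro a b c h hm
    have h1 := ih (a + b + c) (by omega) (fun n hn hp => hU n (by omega) (by omega)) a b c rfl
    have h2 := D.sub_mem (D.add_mem (hrel (X 2 ^ a * U ^ b * V ^ c))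
      (D.smul_mem ((s : ℂ) ^ 2) h1)) hm
    convert h2 using 1
    rw [relation_eq, smul_eq_C_mul]
    ring
  have stepU : ∀ k j : ℕ, k + j = N → X 2 ^ k * U ^ j * V ^ 0 ∈ D := by
    intro k
    induction k with
    | zero =>
      intro j h
      obtain rfl : j = N := by omega
      simpa using hU j le_rfl rfl
    | succ k ihk =>
      intro j h
      have h1 := hlow _ (ihk (j + 1) (by omega))
      cases k with
      | zero =>
        have hc : (-(2 * (j + 1)) : ℂ) ≠ 0 := by
          rw [neg_ne_zero]; exact_mod_cast (by omega : 2 * (j + 1) ≠ 0)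
        refine (D.smul_mem_iff hc).1 ?_
        convert h1 using 1
        simp [Derivation.leibniz_pow, lower_U, smul_eq_C_mul, C_two]
        ring
      | succ k =>
        have h2 := ih (k + j) (by omega) (fun n hn hp => hU n (by omega) (by omega)) k j 0 rfl
        have h3 := D.sub_mem (D.sub_mem h1 (D.smul_mem ((k : ℂ) + 1)
          (hrel (X 2 ^ k * U ^ j)))) (D.smul_mem (((k : ℂ) + 1) * (s : ℂ) ^ 2) h2)
        have hc : (-((k + 1) + 2 * (j + 1)) : ℂ) ≠ 0 := by
          rw [neg_ne_zero]; exact_mod_cast (by omega : (k + 1) + 2 * (j + 1) ≠ 0)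
        refine (D.smul_mem_iff hc).1 ?_
        convert h3 using 1
        rw [relation_eq]
        simp [Derivation.leibniz, Derivation.leibniz_pow, lower_U, lower_Z, smul_eq_C_mul, C_two]
        ring
  have stepV : ∀ c j : ℕ, j + c = N → X 2 ^ j * U ^ 0 * V ^ c ∈ D := by
    intro c
    induction c with
    | zero => exact fun j h => stepU j 0 h
    | succ c ihc =>
      intro j h
      have h1 := hlow _ (ihc (j + 1) (by omega))
      have hc : ((j : ℂ) + 1) ≠ 0 := by exact_mod_cast (by omega : j + 1 ≠ 0)
      refine (D.smul_mem_iff hc).1 ?_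
      convert h1 using 1
      simp [Derivation.leibniz, Derivation.leibniz_pow, lower_V, lower_Z, smul_eq_C_mul]
      ring
  intro a b
  induction b generalizing a with
  | zero => exact fun c h => stepV c a (by omega)
  | succ b ihb =>
    intro c h
    cases c with
    | zero => exact stepU a (b + 1) (by omega)
    | succ c => exact red a b c h (ihb (a + 2) c (by omega))

theorem homogeneous_mem (D : Submodule ℂ (MvPolynomial (Fin 3) ℂ)) (N : ℕ)
    (hD : ∀ a b c : ℕ, a + b + c = N → X 2 ^ a * U ^ b * V ^ c ∈ D)
    (f : MvPolynomial (Fin 3) ℂ) (hf : f.IsHomogeneous N) : f ∈ D := by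
  have key : ∀ n i j a b c : ℕ, i + j = n → i + j + a + b + c = N →
      X 0 ^ i * X 1 ^ j * (X 2 ^ a * U ^ b * V ^ c) ∈ D := by
    intro n
    induction n with
    | zero =>
      intro i j a b c h h'
      obtain ⟨rfl, rfl⟩ : i = 0 ∧ j = 0 := by omega
      simpa using hD a b c (by omega)
    | succ n ih =>
      intro i j a b c h h'
      cases i with
      | succ i =>
        have h1 := D.smul_mem (1 / 2 : ℂ) (D.add_mem (ih i j a (b + 1) c (by omega) (by omega))
          (ih i j a b (c + 1) (by omega) (by omega)))
        have h2 : (C (1 / 2) : MvPolynomial (Fin 3) ℂ) * 2 = 1 := by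
          rw [← C_two, ← C_mul]; norm_num
        convert h1 using 1
        rw [smul_eq_C_mul]
        have h3 : U + V = 2 * X 0 := by rw [U, V]; ring
        linear_combination (-(X 0 ^ i * X 1 ^ j * (X 2 ^ a * U ^ b * V ^ c)) * C (1 / 2)) * h3
          - (X 0 ^ (i + 1) * X 1 ^ j * (X 2 ^ a * U ^ b * V ^ c)) * h2
      | zero =>
        cases j with
        | zero => omega
        | succ j =>
          have h1 := D.smul_mem (-Complex.I / 2 : ℂ) (D.sub_mem
            (ih 0 j a (b + 1) c (by omega) (by omega)) (ih 0 j a b (c + 1) (by omega) (by omega)))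
          have h2 : (C (-Complex.I / 2) : MvPolynomial (Fin 3) ℂ) * (2 * C Complex.I) = 1 := by
            rw [← C_two, ← C_mul, ← C_mul, ← C_1]
            congr 1
            linear_combination -Complex.I_sq
          convert h1 using 1
          rw [smul_eq_C_mul]
          have h3 : U - V = 2 * C Complex.I * X 1 := by rw [U, V]; ring
          linear_combination
            (-(X 0 ^ 0 * X 1 ^ j * (X 2 ^ a * U ^ b * V ^ c)) * C (-Complex.I / 2)) * h3
            - (X 0 ^ 0 * X 1 ^ (j + 1) * (X 2 ^ a * U ^ b * V ^ c)) * h2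
  rw [f.as_sum]
  refine D.sum_mem fun m hm => ?_
  have hdeg : m 0 + m 1 + m 2 = N := by
    have := hf.coeff_eq_zero (d := m)
    have h2 : m.degree = N := by
      by_contra h
      exact (mem_support_iff.1 hm) (this h)
    rw [← h2, Finsupp.degree_eq_sum, Fin.sum_univ_three]
  have hmon : monomial m (coeff m f) =
      coeff m f • (X 0 ^ m 0 * X 1 ^ m 1 * (X 2 ^ m 2 * U ^ 0 * V ^ 0)) := by
    rw [monomial_eq, smul_eq_C_mul, Finsupp.prod_fintype _ _ (by simp), Fin.prod_univ_three]
    ring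
  rw [hmon]
  exact D.smul_mem _ (key _ _ _ _ 0 0 rfl (by omega))

theorem mem_of_U_pow_mem (s : ℝ) (D : Submodule ℂ (MvPolynomial (Fin 3) ℂ))
    (hrel : ∀ f, f * relation s ∈ D) (hlow : ∀ f ∈ D, lower f ∈ D) (N : ℕ)
    (hU : ∀ n ≤ N, n % 2 = N % 2 → U ^ n ∈ D)
    (f : MvPolynomial (Fin 3) ℂ) (hf : f.IsHomogeneous N) : f ∈ D :=
  homogeneous_mem D N (UVZ_mem s D hrel hlow N hU) f hf

theorem eq_top_of_U_pow_mem (s : ℝ) (D : Submodule ℂ (MvPolynomial (Fin 3) ℂ))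
    (hrel : ∀ f, f * relation s ∈ D) (hlow : ∀ f ∈ D, lower f ∈ D) (hU : ∀ n, U ^ n ∈ D) :
    D = ⊤ := by
  refine eq_top_iff.2 fun f _ => ?_
  rw [← sum_homogeneousComponent f]
  exact D.sum_mem fun i _ => mem_of_U_pow_mem s D hrel hlow i (fun n _ _ => hU n) _
    (homogeneousComponent_isHomogeneous i f)

/-! ### Weight decomposition of invariant subspaces -/

/-- The span of the relation and of the weight vectors whose degree lies in `L`. -/
def weightSpan (s : ℝ) (L : Set ℕ) : Submodule ℂ (MvPolynomial (Fin 3) ℂ) :=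
  (Ideal.span {relation s}).restrictScalars ℂ ⊔
    Submodule.span ℂ (Set.image (fun x : ℕ × ℕ => weightVec x.1 x.2) {x | x.1 ∈ L ∧ x.2 ≤ 2 * x.1})

theorem mul_relation_mem_weightSpan (s : ℝ) (L : Set ℕ) (f : MvPolynomial (Fin 3) ℂ) :
    f * relation s ∈ weightSpan s L :=
  Submodule.mem_sup_left (Ideal.mul_mem_left _ _ (Ideal.mem_span_singleton_self _))

theorem weightVec_mem_weightSpan (s : ℝ) {L : Set ℕ} {l k : ℕ} (hl : l ∈ L) (hk : k ≤ 2 * l) :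
    weightVec l k ∈ weightSpan s L :=
  Submodule.mem_sup_right (Submodule.subset_span ⟨(l, k), ⟨hl, hk⟩, rfl⟩)

theorem weightSpan_le (s : ℝ) (L : Set ℕ) (D : Submodule ℂ (MvPolynomial (Fin 3) ℂ))
    (hrel : ∀ f, f * relation s ∈ D)
    (hD : ∀ l ∈ L, ∀ k ≤ 2 * l, weightVec l k ∈ D) : weightSpan s L ≤ D := by
  refine sup_le (fun f hf => ?_) (Submodule.span_le.2 ?_)
  · obtain ⟨g, rfl⟩ := Ideal.mem_span_singleton'.1 (Submodule.restrictScalars_mem ℂ _ _ |>.1 hf)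
    exact hrel g
  · rintro _ ⟨x, ⟨h1, h2⟩, rfl⟩
    exact hD _ h1 _ h2

theorem weightSpan_mono (s : ℝ) {L L' : Set ℕ} (h : L ⊆ L') : weightSpan s L ≤ weightSpan s L' :=
  weightSpan_le s L _ (mul_relation_mem_weightSpan s L') fun _ hl _ hk =>
    weightVec_mem_weightSpan s (h hl) hk

theorem lower_relation (s : ℝ) : lower (relation s) = 0 := by
  rw [relation_eq]
  simp [Derivation.leibniz, Derivation.leibniz_pow, lower_U, lower_V, lower_Z,
    MvPolynomial.derivation_C]
  ring

theorem lower_mem_weightSpan (s : ℝ) (L : Set ℕ) :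
    ∀ f ∈ weightSpan s L, lower f ∈ weightSpan s L := by
  refine weightSpan_le s L (Submodule.comap
    (lower : MvPolynomial (Fin 3) ℂ →ₗ[ℂ] MvPolynomial (Fin 3) ℂ)
      (weightSpan s L)) (fun f => ?_) ?_
  · have h := mul_relation_mem_weightSpan s L (lower f)
    simpa [Derivation.leibniz, lower_relation, mul_comm] using h
  · intro l hl k hk
    change lower (weightVec l k) ∈ weightSpan s L
    rw [lower_weightVec]
    rcases hk.lt_or_eq with hk | rfl
    · exact weightVec_mem_weightSpan s hl hk
    · rw [weightVec_two_mul_succ]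
      exact Submodule.zero_mem _

theorem weightSpan_univ (s : ℝ) : weightSpan s Set.univ = ⊤ :=
  eq_top_of_U_pow_mem s _ (mul_relation_mem_weightSpan s _) (lower_mem_weightSpan s _)
    fun n => weightVec_mem_weightSpan s (Set.mem_univ n) (Nat.zero_le _)

theorem U_pow_mem_of_weightVec_mem (D : Submodule ℂ (MvPolynomial (Fin 3) ℂ))
    (hraise : ∀ f ∈ D, raise f ∈ D) (l k : ℕ) (hk : k ≤ 2 * l) (h : weightVec l k ∈ D) :
    U ^ l ∈ D := by
  induction k with
  | zero => exact h
  | succ k ih =>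
    refine ih (by omega) ?_
    have h1 := hraise _ h
    rw [raise_weightVec_succ] at h1
    refine (D.smul_mem_iff (mul_ne_zero ?_ ?_)).1 h1
    · exact_mod_cast k.succ_ne_zero
    · rw [sub_ne_zero]
      exact_mod_cast (by omega : 2 * l ≠ k)

theorem weightVec_mem_of_U_pow_mem (D : Submodule ℂ (MvPolynomial (Fin 3) ℂ))
    (hlow : ∀ f ∈ D, lower f ∈ D) (l k : ℕ) (h : U ^ l ∈ D) : weightVec l k ∈ D := by
  induction k with
  | zero => exact h
  | succ k ih =>
    rw [← lower_weightVec]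
    exact hlow _ ih

theorem le_weightSpan (s : ℝ) (D : Submodule ℂ (MvPolynomial (Fin 3) ℂ))
    (hrel : ∀ f, f * relation s ∈ D) (hraise : ∀ f ∈ D, raise f ∈ D)
    (hlow : ∀ f ∈ D, lower f ∈ D) (hcartan : ∀ f ∈ D, cartan f ∈ D) :
    D ≤ weightSpan s {l | U ^ l ∈ D} := by
  intro f hf
  have htop : f ∈ weightSpan s Set.univ := by rw [weightSpan_univ]; trivial
  obtain ⟨g, hg, h, hh, rfl⟩ := Submodule.mem_sup.1 htop
  refine Submodule.add_mem _ (Submodule.mem_sup_left hg) ?_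
  obtain ⟨r, rfl⟩ := Ideal.mem_span_singleton'.1 (Submodule.restrictScalars_mem ℂ _ _ |>.1 hg)
  replace hf := (D.add_mem_iff_right (hrel r)).1 hf
  obtain ⟨c, hc, rfl⟩ := (Finsupp.mem_span_image_iff_linearCombination ℂ).1 hh
  rw [Finsupp.mem_supported] at hc
  rw [Finsupp.linearCombination_apply, Finsupp.sum] at hf ⊢
  have hmem := mem_of_sum_eigenvectors_mem sepOp D
    (fun w hw => by
      rw [sepOp_apply]
      exact D.add_mem (hlow _ (hraise _ hw)) (D.smul_mem _ (hcartan _ hw)))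
    sepVal c.support (fun x => c x • weightVec x.1 x.2)
    (fun x _ => by rw [map_smul, sepOp_weightVec, smul_comm])
    (sepVal_injOn.mono fun x hx => (hc hx).2) hf
  refine Submodule.sum_mem _ fun x hx => Submodule.smul_mem _ _ ?_
  have hx' := (D.smul_mem_iff (Finsupp.mem_support_iff.1 hx)).1 (hmem x hx)
  exact weightVec_mem_weightSpan s
    (U_pow_mem_of_weightVec_mem D hraise _ _ (hc hx).2 hx') (hc hx).2

/-! ### Powers of `U` in a Poisson subalgebra -/

theorem ham_pow_left (f g : MvPolynomial (Fin 3) ℂ) (a : ℕ) :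
    ham (f ^ (a + 1)) g = (a + 1 : ℂ) • (f ^ a * ham f g) := by
  rw [ham_antisymm, ham_antisymm f g]
  simp [Derivation.leibniz_pow, smul_eq_C_mul]

theorem ham_pow_right (f g : MvPolynomial (Fin 3) ℂ) (a : ℕ) :
    ham f (g ^ (a + 1)) = (a + 1 : ℂ) • (g ^ a * ham f g) := by
  simp [Derivation.leibniz_pow, smul_eq_C_mul]

theorem ham_U_V : ham U V = (-2 * Complex.I) • X 2 := by
  simp [ham_apply, smul_eq_C_mul, U, V, pderiv_X, C_two]
  ring

theorem ham_U_Z : ham U (X 2) = Complex.I • U := by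
  simp [ham_apply, smul_eq_C_mul, U, pderiv_X]
  linear_combination (-X 1) * C_I_sq

theorem ham_U_U : ham U U = 0 := by
  simp [ham_apply]
  ring

theorem descend_step (s : ℝ) (D : Submodule ℂ (MvPolynomial (Fin 3) ℂ))
    (hrel : ∀ f, f * relation s ∈ D) (hraise : ∀ f ∈ D, raise f ∈ D) (hlow : ∀ f ∈ D, lower f ∈ D)
    (hs : s ≠ 0) (a b : ℕ) (h : X 2 * U ^ (a + 1) * V ^ (b + 1) ∈ D) :
    X 2 * U ^ a * V ^ b ∈ D := by
  have h1 := hraise _ (hlow _ h)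
  have hc : (-(4 * (a + 1) * (b + 1) * (s : ℂ) ^ 2)) ≠ 0 := by
    have ha : (a : ℂ) + 1 ≠ 0 := by exact_mod_cast a.succ_ne_zero
    have hb : (b : ℂ) + 1 ≠ 0 := by exact_mod_cast b.succ_ne_zero
    have hs' : (s : ℂ) ≠ 0 := by exact_mod_cast hs
    simp [ha, hb, hs']
  refine (D.smul_mem_iff hc).1 ?_
  have h2 := D.add_mem (D.sub_mem h1 (D.smul_mem
    (2 + 2 * (b + 1) + 4 * (a + 1) + 4 * (a + 1) * (b + 1) : ℂ) h))
    (D.smul_mem (4 * (a + 1) * (b + 1) : ℂ) (hrel (X 2 * U ^ a * V ^ b)))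
  convert h2 using 1
  have hl : lower (X 2 * U ^ (a + 1) * V ^ (b + 1)) =
      U ^ a * V ^ (b + 1) * (U * V - (2 * (a + 1) : ℂ) • X 2 ^ 2) := by
    simp [Derivation.leibniz, Derivation.leibniz_pow, lower_U, lower_V, lower_Z, smul_eq_C_mul,
      C_two]
    ring
  rw [hl, relation_eq]
  simp [Derivation.leibniz, Derivation.leibniz_pow, raise_U, raise_V, raise_Z, smul_eq_C_mul,
    C_two, C_four, derivation_two]
  ring

theorem descend (s : ℝ) (D : Submodule ℂ (MvPolynomial (Fin 3) ℂ))
    (hrel : ∀ f, f * relation s ∈ D) (hraise : ∀ f ∈ D, raise f ∈ D) (hlow : ∀ f ∈ D, lower f ∈ D)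
    (hs : s ≠ 0) (a b p : ℕ) (h : X 2 * U ^ (a + p) * V ^ (b + p) ∈ D) :
    X 2 * U ^ a * V ^ b ∈ D := by
  induction p with
  | zero => exact h
  | succ p ih => exact ih (descend_step s D hrel hraise hlow hs _ _ h)

theorem Z_mul_U_mul_V_mem (D : Submodule ℂ (MvPolynomial (Fin 3) ℂ))
    (hham : ∀ f ∈ D, ∀ g ∈ D, ham f g ∈ D) (hconj : ∀ l, U ^ l ∈ D → V ^ l ∈ D)
    (a b : ℕ) (ha : U ^ (a + 1) ∈ D) (hb : U ^ (b + 1) ∈ D) :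
    X 2 * U ^ a * V ^ b ∈ D := by
  have h := hham _ ha _ (hconj _ hb)
  have ha : (a : ℂ) + 1 ≠ 0 := by exact_mod_cast a.succ_ne_zero
  have hb : (b : ℂ) + 1 ≠ 0 := by exact_mod_cast b.succ_ne_zero
  refine (D.smul_mem_iff (s := (a + 1) * (b + 1) * (-2 * Complex.I)) (by simp [ha, hb])).1 ?_
  convert h using 1
  rw [ham_pow_left, ham_pow_right, ham_U_V]
  simp only [smul_eq_C_mul, map_mul]
  ring

theorem U_cube_mem (s : ℝ) (D : Submodule ℂ (MvPolynomial (Fin 3) ℂ))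
    (hrel : ∀ f, f * relation s ∈ D) (hraise : ∀ f ∈ D, raise f ∈ D) (hlow : ∀ f ∈ D, lower f ∈ D)
    (hham : ∀ f ∈ D, ∀ g ∈ D, ham f g ∈ D) (hconj : ∀ l, U ^ l ∈ D → V ^ l ∈ D)
    (hs : s ≠ 0) (hZ : X 2 ∈ D) (l : ℕ) (hl : 2 ≤ l) (h : U ^ l ∈ D) :
    U ^ 3 ∈ D := by
  obtain ⟨p, rfl⟩ := Nat.exists_eq_add_of_le' hl
  have h1 := Z_mul_U_mul_V_mem D hham hconj (p + 1) (p + 1) h h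
  rw [add_comm p 1] at h1
  have h2 := descend s D hrel hraise hlow hs 1 1 p h1
  have h3 : X 2 ^ 3 ∈ D := by
    have h4 := D.add_mem (D.sub_mem (hrel (X 2)) h2) (D.smul_mem ((s : ℂ) ^ 2) hZ)
    convert h4 using 1
    rw [relation_eq, smul_eq_C_mul]
    ring
  have h5 := hraise _ (hraise _ (hraise _ h3))
  refine (D.smul_mem_iff (s := (-6 : ℂ)) (by norm_num)).1 ?_
  convert h5 using 1
  have h7 : raise (X 2 ^ 3) = (-3 : ℂ) • (X 2 ^ 2 * U) := by
    simp [Derivation.leibniz_pow, raise_Z, smul_eq_C_mul, C_three]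
  rw [h7, Derivation.map_smul, Derivation.map_smul]
  simp [Derivation.leibniz, Derivation.leibniz_pow, raise_Z, raise_U, smul_eq_C_mul, C_three, C_six,
    derivation_two]
  ring

theorem U_pow_add_mem (D : Submodule ℂ (MvPolynomial (Fin 3) ℂ))
    (hlow : ∀ f ∈ D, lower f ∈ D) (hham : ∀ f ∈ D, ∀ g ∈ D, ham f g ∈ D)
    (a b : ℕ) (ha : U ^ (a + 1) ∈ D) (hb : U ^ (b + 2) ∈ D) :
    U ^ (a + b + 2) ∈ D := by
  have h := hham _ ha _ (hlow _ hb)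
  have ha : (a : ℂ) + 1 ≠ 0 := by exact_mod_cast a.succ_ne_zero
  have hb : (b : ℂ) + 2 ≠ 0 := by exact_mod_cast (by omega : b + 2 ≠ 0)
  refine (D.smul_mem_iff (s := -2 * (a + 1) * (b + 2) * Complex.I) (by simp [ha, hb])).1 ?_
  convert h using 1
  have hl : lower (U ^ (b + 2)) = (-2 * (b + 2) : ℂ) • (U ^ (b + 1) * X 2) := by
    simp [Derivation.leibniz_pow, lower_U, smul_eq_C_mul, C_two]
    ring
  rw [hl, ham_pow_left, Derivation.map_smul, Derivation.leibniz, ham_pow_right, ham_U_U, ham_U_Z]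
  simp [smul_eq_C_mul, C_two]
  ring

theorem U_pow_odd_mem (D : Submodule ℂ (MvPolynomial (Fin 3) ℂ))
    (hlow : ∀ f ∈ D, lower f ∈ D) (hham : ∀ f ∈ D, ∀ g ∈ D, ham f g ∈ D)
    (h1 : U ^ 1 ∈ D) (h3 : U ^ 3 ∈ D) (n : ℕ) (hn : Odd n) : U ^ n ∈ D := by
  obtain ⟨m, rfl⟩ := hn
  induction m with
  | zero => exact h1
  | succ m ih => exact U_pow_add_mem D hlow hham (2 * m) 1 ih h3

theorem U_pow_mem_of_even (s : ℝ) (D : Submodule ℂ (MvPolynomial (Fin 3) ℂ))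
    (hrel : ∀ f, f * relation s ∈ D) (hraise : ∀ f ∈ D, raise f ∈ D) (hlow : ∀ f ∈ D, lower f ∈ D)
    (hham : ∀ f ∈ D, ∀ g ∈ D, ham f g ∈ D) (hconj : ∀ l, U ^ l ∈ D → V ^ l ∈ D)
    (hs : s ≠ 0) (h0 : 1 ∈ D) (h1 : U ^ 1 ∈ D) (hZ : X 2 ∈ D) (l : ℕ)
    (hl : 2 ≤ l) (he : Even l) (h : U ^ l ∈ D) (n : ℕ) : U ^ n ∈ D := by
  have h3 := U_cube_mem s D hrel hraise hlow hham hconj hs hZ l hl h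
  have h2 : U ^ 2 ∈ D := by
    obtain ⟨p, rfl⟩ := Nat.exists_eq_add_of_le' hl
    have h4 := Z_mul_U_mul_V_mem D hham hconj (p + 2) (p + 1)
      (U_pow_odd_mem D hlow hham h1 h3 _ he.add_one) h
    have h5 := hraise _ (descend s D hrel hraise hlow hs 1 0 (p + 1)
      (by convert h4 using 3 <;> ring))
    rw [← D.neg_mem_iff]
    convert h5 using 1
    simp [Derivation.leibniz, raise_Z, raise_U]
    ring
  induction n with
  | zero => simpa using h0
  | succ n ih =>
    cases n with
    | zero => exact h1
    | succ n => exact U_pow_add_mem D hlow hham n 0 ih h2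

/-! ### Complexification of subspaces of real polynomials -/

theorem toComplex_smul (r : ℝ) (f : MvPolynomial (Fin 3) ℝ) :
    toComplex (r • f) = C (r : ℂ) * toComplex f := by
  simp [toComplex, smul_eq_C_mul]

/-- The subspace `W + iW` of complex polynomials. -/
def complexify (W : Submodule ℝ (MvPolynomial (Fin 3) ℝ)) :
    Submodule ℂ (MvPolynomial (Fin 3) ℂ) where
  carrier := {f | ∃ p ∈ W, ∃ q ∈ W, f = toComplex p + C Complex.I * toComplex q}
  zero_mem' := ⟨0, W.zero_mem, 0, W.zero_mem, by simp⟩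
  add_mem' := by
    rintro _ _ ⟨p, hp, q, hq, rfl⟩ ⟨p', hp', q', hq', rfl⟩
    exact ⟨p + p', W.add_mem hp hp', q + q', W.add_mem hq hq', by simp only [map_add]; ring⟩
  smul_mem' := by
    rintro c _ ⟨p, hp, q, hq, rfl⟩
    refine ⟨c.re • p - c.im • q, W.sub_mem (W.smul_mem _ hp) (W.smul_mem _ hq),
      c.im • p + c.re • q, W.add_mem (W.smul_mem _ hp) (W.smul_mem _ hq), ?_⟩
    rw [map_sub, map_add, toComplex_smul, toComplex_smul, toComplex_smul, toComplex_smul,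
      smul_eq_C_mul]
    nth_rewrite 1 [← Complex.re_add_im c]
    rw [C_add, C_mul]
    linear_combination (C (c.im : ℂ) * toComplex q) * C_I_sq

section Complexify

variable {W : Submodule ℝ (MvPolynomial (Fin 3) ℝ)}

theorem toComplex_mem_complexify {f : MvPolynomial (Fin 3) ℝ} :
    toComplex f ∈ complexify W ↔ f ∈ W := by
  refine ⟨?_, fun h => ⟨f, h, 0, W.zero_mem, by simp⟩⟩
  rintro ⟨p, hp, q, hq, h⟩
  convert hp
  ext m
  have := congrArg (fun g => (coeff m g).re) h
  simpa [toComplex, coeff_map] using this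

theorem X_mem_complexify {i : Fin 3} (h : X i ∈ W) :
    (X i : MvPolynomial (Fin 3) ℂ) ∈ complexify W := by
  simpa [toComplex] using toComplex_mem_complexify.2 h

theorem U_mem_complexify (h : ∀ i, X i ∈ W) : U ∈ complexify W := by
  rw [U, ← smul_eq_C_mul]
  exact Submodule.add_mem _ (X_mem_complexify (h 0))
    (Submodule.smul_mem _ _ (X_mem_complexify (h 1)))

theorem V_mem_complexify (h : ∀ i, X i ∈ W) : V ∈ complexify W := by
  rw [V, ← smul_eq_C_mul]
  exact Submodule.sub_mem _ (X_mem_complexify (h 0))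
    (Submodule.smul_mem _ _ (X_mem_complexify (h 1)))

theorem complexify_mono {W' : Submodule ℝ (MvPolynomial (Fin 3) ℝ)} (h : W ≤ W') :
    complexify W ≤ complexify W' := by
  rintro _ ⟨p, hp, q, hq, rfl⟩
  exact ⟨p, h hp, q, h hq, rfl⟩

theorem le_of_complexify_le {W' : Submodule ℝ (MvPolynomial (Fin 3) ℝ)}
    (h : complexify W ≤ complexify W') : W ≤ W' := fun _ hf =>
  toComplex_mem_complexify.1 (h (toComplex_mem_complexify.2 hf))

theorem mem_complexify_top (f : MvPolynomial (Fin 3) ℂ) : f ∈ complexify ⊤ := by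
  induction f using MvPolynomial.induction_on with
  | C a =>
    have h : (1 : MvPolynomial (Fin 3) ℂ) ∈ complexify ⊤ := by
      simpa using toComplex_mem_complexify.2 (Submodule.mem_top (x := 1))
    simpa [smul_eq_C_mul] using Submodule.smul_mem _ a h
  | add p q hp hq => exact Submodule.add_mem _ hp hq
  | mul_X p i hp =>
    obtain ⟨a, -, b, -, rfl⟩ := hp
    exact ⟨a * X i, trivial, b * X i, trivial, by simp [toComplex]; ring⟩

theorem mul_relation_mem_complexify {s : ℝ}
    (h : ∀ f, f * (X 0 ^ 2 + X 1 ^ 2 + X 2 ^ 2 - C (s ^ 2)) ∈ W) (f : MvPolynomial (Fin 3) ℂ) :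
    f * relation s ∈ complexify W := by
  obtain ⟨a, -, b, -, rfl⟩ := mem_complexify_top f
  refine ⟨_, h a, _, h b, ?_⟩
  simp [toComplex, relation]
  ring

theorem ham_add_left (f f' g : MvPolynomial (Fin 3) ℂ) :
    ham (f + f') g = ham f g + ham f' g := by
  rw [ham_antisymm, map_add, ham_antisymm f, ham_antisymm f']; ring

theorem ham_C_mul_left (c : ℂ) (f g : MvPolynomial (Fin 3) ℂ) :
    ham (C c * f) g = C c * ham f g := by
  rw [ham_antisymm, ← smul_eq_C_mul, Derivation.map_smul, ham_antisymm f, smul_eq_C_mul]; ring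

theorem ham_C_mul_right (c : ℂ) (f g : MvPolynomial (Fin 3) ℂ) :
    ham f (C c * g) = C c * ham f g := by
  rw [← smul_eq_C_mul, Derivation.map_smul, smul_eq_C_mul]

theorem ham_mem_complexify (h : ∀ f ∈ W, ∀ g ∈ W, ham f g ∈ W) :
    ∀ f ∈ complexify W, ∀ g ∈ complexify W, ham f g ∈ complexify W := by
  rintro _ ⟨p, hp, q, hq, rfl⟩ _ ⟨p', hp', q', hq', rfl⟩
  refine ⟨_, W.sub_mem (h p hp p' hp') (h q hq q' hq'),
    _, W.add_mem (h p hp q' hq') (h q hq p' hp'), ?_⟩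
  simp only [ham_add_left, map_add, map_sub, ham_C_mul_left, ham_C_mul_right, toComplex_ham]
  linear_combination (ham (toComplex q) (toComplex q')) * C_I_sq

theorem lower_mem_complexify (h : ∀ i, ∀ f ∈ W, ham (X i) f ∈ W) :
    ∀ f ∈ complexify W, lower f ∈ complexify W := by
  rintro _ ⟨p, hp, q, hq, rfl⟩
  have hV : V = toComplex (X 0) + C (-Complex.I) * toComplex (X 1) := by
    simp [toComplex, V]
    ring
  refine ⟨_, W.sub_mem (h 1 p hp) (h 0 q hq), _, W.add_mem (h 0 p hp) (h 1 q hq), ?_⟩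
  rw [lower, Derivation.smul_apply, smul_eq_C_mul, hV]
  simp only [ham_add_left, map_add, map_sub, ham_C_mul_left, ham_C_mul_right, toComplex_ham]
  rw [C_neg]
  linear_combination (ham (toComplex (X 0)) (toComplex q) - ham (toComplex (X 1)) (toComplex p)
    - C Complex.I * ham (toComplex (X 1)) (toComplex q)) * C_I_sq

theorem V_pow_mem_complexify (l : ℕ) (h : U ^ l ∈ complexify W) : V ^ l ∈ complexify W := by
  obtain ⟨p, hp, q, hq, h⟩ := h
  refine ⟨p, hp, -q, W.neg_mem hq, ?_⟩
  have h2 := congrArg (map (starRingEnd ℂ)) h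
  have hc : ∀ f : MvPolynomial (Fin 3) ℝ, map (starRingEnd ℂ) (toComplex f) = toComplex f := by
    intro f
    have hR : (starRingEnd ℂ).comp (algebraMap ℝ ℂ) = algebraMap ℝ ℂ := RingHom.ext fun x => by simp
    rw [toComplex, map_map, hR]
  simp only [map_pow, map_add, map_mul, hc, map_C, Complex.conj_I, U, map_X] at h2
  rw [V, map_neg]
  rw [C_neg] at h2
  linear_combination h2

end Complexify

/-! ### Harmonic polynomials -/

theorem pderiv_comm {K : Type*} [CommRing K] (i j : Fin 3) (f : MvPolynomial (Fin 3) K) :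
    pderiv i (pderiv j f) = pderiv j (pderiv i f) := by
  have : ⁅(pderiv i : Derivation K (MvPolynomial (Fin 3) K) (MvPolynomial (Fin 3) K)),
      (pderiv j : Derivation K (MvPolynomial (Fin 3) K) (MvPolynomial (Fin 3) K))⁆ = 0 := by
    refine derivation_ext fun k => ?_
    rw [Derivation.commutator_apply]
    simp only [pderiv_X, Derivation.coe_zero, Pi.zero_apply]
    simp [Pi.single_apply]
    split_ifs <;> simp
  have h := DFunLike.congr_fun this f
  rwa [Derivation.commutator_apply, Derivation.zero_apply, sub_eq_zero] at h

theorem laplacian_apply (f : MvPolynomial (Fin 3) ℝ) :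
    laplacian f = pderiv 0 (pderiv 0 f) + pderiv 1 (pderiv 1 f) + pderiv 2 (pderiv 2 f) := rfl

theorem laplacian_X_mul (a : Fin 3) (f : MvPolynomial (Fin 3) ℝ) :
    laplacian (X a * f) = X a * laplacian f + 2 * pderiv a f := by
  fin_cases a <;> simp [laplacian_apply, Derivation.leibniz, pderiv_X] <;> ring

theorem laplacian_pderiv (a : Fin 3) (f : MvPolynomial (Fin 3) ℝ) :
    laplacian (pderiv a f) = pderiv a (laplacian f) := by
  simp only [laplacian_apply, map_add, pderiv_comm _ a]

theorem isHomogeneous_X_mul_pderiv {f : MvPolynomial (Fin 3) ℝ} {l : ℕ} (h : f.IsHomogeneous l)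
    (i j : Fin 3) : (X i * pderiv j f).IsHomogeneous l := by
  cases l with
  | zero =>
    rw [totalDegree_eq_zero_iff_eq_C.1 (Nat.le_zero.1 h.totalDegree_le)]
    simp [isHomogeneous_zero]
  | succ l =>
    have := (isHomogeneous_X ℝ i).mul (h.pderiv (i := j))
    rwa [Nat.add_sub_cancel, add_comm] at this

theorem ham_X_mem_harmonicHomog (l : ℕ) (i : Fin 3) :
    ∀ f ∈ harmonicHomog l, ham (X i) f ∈ harmonicHomog l := by
  rintro f ⟨hf, hΔ⟩
  have hf : f.IsHomogeneous l := hf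
  have hΔ : laplacian f = 0 := hΔ
  have key : ∀ a b : Fin 3, laplacian (X a * pderiv b f - X b * pderiv a f) = 0 := by
    intro a b
    rw [map_sub, laplacian_X_mul, laplacian_X_mul, laplacian_pderiv, laplacian_pderiv, hΔ,
      pderiv_comm a b]
    simp
  have key2 : ∀ a b : Fin 3, X a * pderiv b f - X b * pderiv a f ∈ harmonicHomog l := fun a b =>
    ⟨(isHomogeneous_X_mul_pderiv hf a b).sub (isHomogeneous_X_mul_pderiv hf b a), key a b⟩
  fin_cases i
  · convert key2 2 1 using 1
    simp [ham_apply, pderiv_X]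
    ring
  · convert key2 0 2 using 1
    simp [ham_apply, pderiv_X]
    ring
  · convert key2 1 0 using 1
    simp [ham_apply, pderiv_X]
    ring

theorem U_pow_mem_complexify_harmonicHomog (l : ℕ) : U ^ l ∈ complexify (harmonicHomog l) := by
  have key : ∃ p q : MvPolynomial (Fin 3) ℝ, U ^ l = toComplex p + C Complex.I * toComplex q ∧
      p.IsHomogeneous l ∧ q.IsHomogeneous l ∧ pderiv 0 p = pderiv 1 q ∧
      pderiv 1 p = -pderiv 0 q ∧ pderiv 2 p = 0 ∧ pderiv 2 q = 0 := by
    induction l with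
    | zero => exact ⟨1, 0, by simp, isHomogeneous_one _ _, isHomogeneous_zero _ _ _, by simp⟩
    | succ l ih =>
      obtain ⟨p, q, h, hp, hq, h0, h1, h2, h3⟩ := ih
      refine ⟨p * X 0 - q * X 1, q * X 0 + p * X 1, ?_,
        (hp.mul (isHomogeneous_X ℝ 0)).sub (hq.mul (isHomogeneous_X ℝ 1)),
        (hq.mul (isHomogeneous_X ℝ 0)).add (hp.mul (isHomogeneous_X ℝ 1)), ?_⟩
      · rw [pow_succ, h, U]
        simp [toComplex]
        linear_combination (map (algebraMap ℝ ℂ) q * X 1) * C_I_sq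
      · simp [Derivation.leibniz, pderiv_X, h0, h1, h2, h3]
        constructor <;> ring
  obtain ⟨p, q, h, hp, hq, h0, h1, h2, h3⟩ := key
  refine ⟨p, ⟨hp, ?_⟩, q, ⟨hq, ?_⟩, h⟩
  · change laplacian p = 0
    rw [laplacian_apply, h0, h1, h2, pderiv_comm 0 1]
    simp
  · change laplacian q = 0
    rw [laplacian_apply, ← h0, h3, eq_neg_iff_add_eq_zero.1 h1 |> eq_neg_of_add_eq_zero_right,
      pderiv_comm 1 0]
    simp


/-! ### Poisson subalgebras of the sphere -/

theorem ham_sphere (s : ℝ) (f : MvPolynomial (Fin 3) ℝ) :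
    ham f (X 0 ^ 2 + X 1 ^ 2 + X 2 ^ 2 - C (s ^ 2)) = 0 := by
  simp only [map_sub, map_add, Derivation.leibniz_pow, ham_apply, pderiv_X,
    MvPolynomial.derivation_C]
  simp
  ring

theorem ham_mem_sphereIdeal {s : ℝ} {g : MvPolynomial (Fin 3) ℝ} (f : MvPolynomial (Fin 3) ℝ)
    (hg : g ∈ sphereIdeal s) : ham f g ∈ sphereIdeal s := by
  obtain ⟨a, rfl⟩ := Ideal.mem_span_singleton'.1 hg
  rw [Derivation.leibniz, ham_sphere, smul_zero, zero_add, smul_eq_mul]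
  exact Ideal.mul_mem_right _ _ (Ideal.mem_span_singleton_self _)

theorem toSphere_ham_congr {s : ℝ} {f f' g g' : MvPolynomial (Fin 3) ℝ}
    (hf : toSphere s f = toSphere s f') (hg : toSphere s g = toSphere s g') :
    toSphere s (ham f g) = toSphere s (ham f' g') := by
  have h1 : toSphere s (ham f g) = toSphere s (ham f g') := by
    refine Ideal.Quotient.eq.2 ?_
    rw [← map_sub]
    exact ham_mem_sphereIdeal f (Ideal.Quotient.eq.1 hg)
  have h2 : toSphere s (ham g' f) = toSphere s (ham g' f') := by
    refine Ideal.Quotient.eq.2 ?_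
    rw [← map_sub]
    exact ham_mem_sphereIdeal g' (Ideal.Quotient.eq.1 hf)
  rw [h1, ham_antisymm f, ham_antisymm f', map_neg, map_neg, h2]

theorem toSphere_rep (s : ℝ) (p : SpherePoly s) : toSphere s (rep s p) = p :=
  (Ideal.Quotient.mk_surjective (I := sphereIdeal s) p).choose_spec

theorem pbS_toSphere (s : ℝ) (f g : MvPolynomial (Fin 3) ℝ) :
    pbS s (toSphere s f) (toSphere s g) = toSphere s (ham f g) := by
  rw [pbS, pb_eq_ham]
  exact toSphere_ham_congr (toSphere_rep s _) (toSphere_rep s _)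

/-- The preimage of a subspace of `P` in the real polynomial ring. -/
def preimage {s : ℝ} (W : Submodule ℝ (SpherePoly s)) :
    Submodule ℝ (MvPolynomial (Fin 3) ℝ) :=
  W.comap (Ideal.Quotient.mkₐ ℝ (sphereIdeal s)).toLinearMap

section Preimage

variable {s : ℝ} {W : Submodule ℝ (SpherePoly s)}

theorem mem_preimage {f : MvPolynomial (Fin 3) ℝ} : f ∈ preimage W ↔ toSphere s f ∈ W := Iff.rfl

theorem le_of_preimage_le {W' : Submodule ℝ (SpherePoly s)} (h : preimage W ≤ preimage W') :
    W ≤ W' := by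
  intro p hp
  rw [← toSphere_rep s p] at hp ⊢
  exact h hp

theorem mul_sphere_mem_preimage (f : MvPolynomial (Fin 3) ℝ) :
    f * (X 0 ^ 2 + X 1 ^ 2 + X 2 ^ 2 - C (s ^ 2)) ∈ preimage W := by
  have h : toSphere s (f * (X 0 ^ 2 + X 1 ^ 2 + X 2 ^ 2 - C (s ^ 2))) = 0 :=
    Ideal.Quotient.eq_zero_iff_mem.2
      (Ideal.mul_mem_left _ _ (Ideal.mem_span_singleton_self _))
  rw [mem_preimage, h]
  exact W.zero_mem

theorem mul_relation_mem_complexify_preimage (f : MvPolynomial (Fin 3) ℂ) :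
    f * relation s ∈ complexify (preimage W) :=
  mul_relation_mem_complexify mul_sphere_mem_preimage f

theorem one_mem_complexify_preimage (h : 1 ∈ W) : 1 ∈ complexify (preimage W) := by
  rw [← map_one toComplex]
  exact toComplex_mem_complexify.2 (by rwa [mem_preimage, map_one])

theorem harmonicHomog_le_preimage_Otilde (s : ℝ) {l : ℕ} (hl : Odd l) :
    harmonicHomog l ≤ preimage (Otilde s) := fun f hf =>
  Submodule.mem_sup_right
    (le_iSup₂ (f := fun (l : ℕ) (_ : Odd l) => Hsph s l) l hl ⟨f, hf, rfl⟩)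

theorem weightVec_mem_complexify_harmonicHomog (l k : ℕ) :
    weightVec l k ∈ complexify (harmonicHomog l) :=
  weightVec_mem_of_U_pow_mem _ (lower_mem_complexify (ham_X_mem_harmonicHomog l)) l k
    (U_pow_mem_complexify_harmonicHomog l)

theorem weightSpan_odd_le (s : ℝ) :
    weightSpan s {l | l = 0 ∨ Odd l} ≤ complexify (preimage (Otilde s)) := by
  refine weightSpan_le s _ _ mul_relation_mem_complexify_preimage ?_
  rintro l (rfl | hl) k hk
  · obtain rfl : k = 0 := by omega
    simpa using one_mem_complexify_preimage (one_mem_Otilde s)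
  · exact complexify_mono (harmonicHomog_le_preimage_Otilde s hl)
      (weightVec_mem_complexify_harmonicHomog l k)

theorem weightSpan_le_one_le (s : ℝ) :
    weightSpan s {l | l < 2} ≤ complexify (preimage (P1 s)) := by
  have hX : ∀ i, X i ∈ preimage (P1 s) := S_mem_P1 s
  refine weightSpan_le s _ _ mul_relation_mem_complexify_preimage ?_
  intro l hl k hk
  replace hl : l < 2 := hl
  interval_cases l
  · obtain rfl : k = 0 := by omega
    simpa using one_mem_complexify_preimage (one_mem_P1 s)
  · have hk : k ≤ 2 := hk
    have h1 : weightVec 1 1 = (-2 : ℂ) • X 2 := by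
      rw [← lower_weightVec]
      simp [lower_U, smul_eq_C_mul, C_two]
    interval_cases k
    · simpa using U_mem_complexify hX
    · rw [h1]
      exact Submodule.smul_mem _ _ (X_mem_complexify (hX 2))
    · rw [← lower_weightVec, h1, Derivation.map_smul, lower_Z]
      exact Submodule.smul_mem _ _ (V_mem_complexify hX)

theorem eq_top_of_complexify_preimage_eq_top (h : complexify (preimage W) = ⊤) : W = ⊤ := by
  refine eq_top_iff.2 (le_of_preimage_le (le_of_complexify_le ?_))
  rw [h]
  exact le_top

theorem Otilde_le (h1 : 1 ∈ W)
    (hlow : ∀ f ∈ complexify (preimage W), lower f ∈ complexify (preimage W))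
    (hodd : ∀ n, Odd n → U ^ n ∈ complexify (preimage W)) : Otilde s ≤ W := by
  refine sup_le (by simpa using h1) (iSup₂_le fun l hl => ?_)
  rintro _ ⟨f, ⟨hf, -⟩, rfl⟩
  have hf : f.IsHomogeneous l := hf
  refine mem_preimage.1 (toComplex_mem_complexify.1 ?_)
  exact mem_of_U_pow_mem s _ mul_relation_mem_complexify_preimage hlow l
    (fun n _ hn => hodd n (Nat.odd_iff.2 (hn.trans (Nat.odd_iff.1 hl)))) _ (hf.map _)

end Preimage

end SpherePoisson


open SpherePoisson

/-- Classification of Poisson subalgebras above `P¹`: the only Poisson subalgebras of `P`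
containing `P¹` are `P¹`, `Õ` and `P` itself. -/
theorem subalgebras_above_P1 (s : ℝ) (hs : 0 < s)
    (Cs : Submodule ℝ (SpherePoly s))
    (hpoisson : ∀ p ∈ Cs, ∀ q ∈ Cs, pbS s p q ∈ Cs)
    (h : P1 s ≤ Cs) :
    Cs = P1 s ∨ Cs = Otilde s ∨ Cs = ⊤ := by
  have hone : (1 : SpherePoly s) ∈ Cs := h (one_mem_P1 s)
  have hX : ∀ i, X i ∈ preimage Cs := fun i => h (S_mem_P1 s i)
  have hrel := mul_relation_mem_complexify_preimage (W := Cs)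
  have hham := ham_mem_complexify (W := preimage Cs) fun f hf g hg => by
    rw [mem_preimage, ← pbS_toSphere]
    exact hpoisson _ hf _ hg
  have hconj := V_pow_mem_complexify (W := preimage Cs)
  have hone' := one_mem_complexify_preimage hone
  have hU := U_mem_complexify hX
  have hZ := X_mem_complexify (hX 2)
  set D := complexify (preimage Cs)
  have hraise : ∀ f ∈ D, raise f ∈ D := fun f hf => D.smul_mem _ (hham _ hU f hf)
  have hlow : ∀ f ∈ D, lower f ∈ D := fun f hf =>
    D.smul_mem _ (hham _ (V_mem_complexify hX) f hf)
  have hcartan : ∀ f ∈ D, cartan f ∈ D := fun f hf => D.smul_mem _ (hham _ hZ f hf)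
  have hU1 : U ^ 1 ∈ D := by rwa [pow_one]
  have hle := le_weightSpan s D hrel hraise hlow hcartan
  by_cases hsmall : ∀ l, U ^ l ∈ D → l < 2
  · left
    refine le_antisymm (le_of_preimage_le (le_of_complexify_le (hle.trans ?_))) h
    exact (weightSpan_mono s hsmall).trans (weightSpan_le_one_le s)
  push Not at hsmall
  obtain ⟨m, hm, hm2⟩ := hsmall
  right
  by_cases heven : ∃ l, 2 ≤ l ∧ Even l ∧ U ^ l ∈ D
  · obtain ⟨l, hl, he, hl'⟩ := heven
    right
    exact eq_top_of_complexify_preimage_eq_top (eq_top_of_U_pow_mem s D hrel hlow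
      (U_pow_mem_of_even s D hrel hraise hlow hham hconj hs.ne' hone' hU1 hZ l hl he hl'))
  · left
    have h3 := U_cube_mem s D hrel hraise hlow hham hconj hs.ne' hZ m hm2 hm
    refine le_antisymm (le_of_preimage_le (le_of_complexify_le (hle.trans ?_)))
      (Otilde_le hone hlow (U_pow_odd_mem D hlow hham hU1 h3))
    refine (weightSpan_mono s fun l hl => ?_).trans (weightSpan_odd_le s)
    by_contra hcon
    simp only [Set.mem_ofPred_eq, not_or, Nat.not_odd_iff_even] at hcon
    exact heven ⟨l, by obtain ⟨h0, k, rfl⟩ := hcon; omega, hcon.2, hl⟩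

end
end

section
/- Nonvanishing of harmonic components of brackets of spherical harmonics: (i) for every integer l ≥ 1 there exist p, q ∈ H_l such that the degree-(2l−1) harmonic component of {p,q} is nonzero; (ii) for every odd integer l ≥ 5 there exist p, q ∈ H_l such that the degree-d harmonic component of {p,q} is nonzero for every odd d with l−2 ≤ d ≤ 2l−1. -/
open MvPolynomial MeasureTheory

noncomputable section

attribute [local instance] Classical.propDecidable

/-- The degree-`k` harmonic component of `p ∈ P`: the (unique) element `q ∈ H_k` such that
`p - q` lies in the sum of the `H_l` over `l ≠ k`.  (Existence and uniqueness hold since `P`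
is the internal direct sum of the `H_l`.) -/
def hcomp (s : ℝ) (k : ℕ) (p : SpherePoly s) : SpherePoly s :=
  if h : ∃ q, q ∈ Hsph s k ∧ p - q ∈ ⨆ (l : ℕ) (_ : l ≠ k), Hsph s l then h.choose else 0


/-- Moments of the standard Gaussian distribution. -/
def gaussMoment : ℕ → ℝ
  | 0 => 1
  | 1 => 0
  | n + 2 => (n + 1) * gaussMoment n

theorem gaussMoment_succ (n : ℕ) : gaussMoment (n + 1) = n * gaussMoment (n - 1) := by
  cases n with
  | zero => simp [gaussMoment]
  | succ n => simp [gaussMoment]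

/-- The expectation of a polynomial in three independent standard Gaussian variables. -/
def gaussE : MvPolynomial (Fin 3) ℝ →ₗ[ℝ] ℝ :=
  (basisMonomials (Fin 3) ℝ).constr ℝ fun a => ∏ i, gaussMoment (a i)

theorem gaussE_monomial (a : Fin 3 →₀ ℕ) (c : ℝ) :
    gaussE (monomial a c) = c * ∏ i, gaussMoment (a i) := by
  have h : monomial a c = c • basisMonomials (Fin 3) ℝ a := by
    simp [smul_monomial]
  rw [h, map_smul, gaussE, Module.Basis.constr_basis, smul_eq_mul]

theorem gaussE_C (c : ℝ) : gaussE (C c) = c := by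
  rw [← monomial_zero', gaussE_monomial]
  simp [gaussMoment]

/-- Gaussian integration by parts. -/
theorem gaussE_X_mul (i : Fin 3) (p : MvPolynomial (Fin 3) ℝ) :
    gaussE (X i * p) = gaussE (pderiv i p) := by
  induction p using induction_on' with
  | monomial a c =>
    rw [pderiv_monomial, X, monomial_mul, gaussE_monomial, gaussE_monomial]
    fin_cases i <;>
      simp [Fin.prod_univ_three, Finsupp.single_apply, add_comm 1, gaussMoment_succ] <;> ring
  | add p q hp hq => simp only [mul_add, map_add, hp, hq]

/-- Euler's identity in three variables. -/
theorem euler_identity {n : ℕ} {p : MvPolynomial (Fin 3) ℝ} (hp : p.IsHomogeneous n) :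
    X 0 * pderiv 0 p + X 1 * pderiv 1 p + X 2 * pderiv 2 p = (n : ℝ) • p := by
  rw [← Fin.sum_univ_three (fun i => X i * pderiv i p), hp.sum_X_mul_pderiv, Nat.cast_smul_eq_nsmul]

theorem mem_harmonicHomog {l : ℕ} {p : MvPolynomial (Fin 3) ℝ} :
    p ∈ harmonicHomog l ↔ p.IsHomogeneous l ∧ laplacian p = 0 := Iff.rfl

theorem exists_eq_C_of_isHomogeneous_zero {p : MvPolynomial (Fin 3) ℝ} (hp : p.IsHomogeneous 0) :
    ∃ c, p = C c :=
  ⟨_, totalDegree_eq_zero_iff_eq_C.1 ((totalDegree_zero_iff_isHomogeneous _).2 hp)⟩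

/-- The squared radius. -/
def radiusSq : MvPolynomial (Fin 3) ℝ := X 0 ^ 2 + X 1 ^ 2 + X 2 ^ 2

theorem radiusSq_isHomogeneous : radiusSq.IsHomogeneous 2 :=
  ((isHomogeneous_X_pow _ 2).add (isHomogeneous_X_pow _ 2)).add (isHomogeneous_X_pow _ 2)

theorem radiusSq_ne_zero : radiusSq ≠ 0 := by
  intro h
  have := congrArg (MvPolynomial.eval (fun _ => (1 : ℝ))) h
  norm_num [radiusSq] at this

/-- The inner product of the gradients of two polynomials. -/
def gradInner (f q : MvPolynomial (Fin 3) ℝ) : MvPolynomial (Fin 3) ℝ :=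
  pderiv 0 f * pderiv 0 q + pderiv 1 f * pderiv 1 q + pderiv 2 f * pderiv 2 q

theorem laplacian_apply (p : MvPolynomial (Fin 3) ℝ) :
    laplacian p = pderiv 0 (pderiv 0 p) + pderiv 1 (pderiv 1 p) + pderiv 2 (pderiv 2 p) := rfl

theorem gradInner_comm (f q : MvPolynomial (Fin 3) ℝ) : gradInner f q = gradInner q f := by
  simp only [gradInner]; ring

theorem laplacian_mul (f q : MvPolynomial (Fin 3) ℝ) :
    laplacian (f * q) = f * laplacian q + laplacian f * q + 2 * gradInner f q := by
  simp only [laplacian_apply, gradInner, pderiv_mul, map_add]; ring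

theorem pderiv_comm (i j : Fin 3) (p : MvPolynomial (Fin 3) ℝ) :
    pderiv i (pderiv j p) = pderiv j (pderiv i p) := by
  have h : ⁅pderiv (R := ℝ) i, pderiv (R := ℝ) j⁆ = 0 := by
    apply derivation_ext
    intro k
    simp [Derivation.commutator_apply, pderiv_X, Pi.single_apply, apply_ite]
  have := congrArg (fun D => D p) h
  simpa [Derivation.commutator_apply, sub_eq_zero] using this

theorem laplacian_pderiv (i : Fin 3) (p : MvPolynomial (Fin 3) ℝ) :
    laplacian (pderiv i p) = pderiv i (laplacian p) := by
  simp only [laplacian_apply, map_add, pderiv_comm _ i]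

theorem isHomogeneous_laplacian {n : ℕ} {p : MvPolynomial (Fin 3) ℝ} (hp : p.IsHomogeneous n) :
    (laplacian p).IsHomogeneous (n - 2) :=
  ((hp.pderiv.pderiv).add (hp.pderiv.pderiv)).add (hp.pderiv.pderiv)

theorem gaussE_mul_homogeneous {n : ℕ} {q : MvPolynomial (Fin 3) ℝ} (hq : q.IsHomogeneous n)
    (f : MvPolynomial (Fin 3) ℝ) :
    n * gaussE (f * q) = gaussE (f * laplacian q) + gaussE (gradInner f q) := by
  have h : (n : ℝ) • (f * q) = X 0 * (f * pderiv 0 q) + X 1 * (f * pderiv 1 q)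
      + X 2 * (f * pderiv 2 q) := by
    rw [← mul_smul_comm, ← euler_identity hq]; ring
  rw [← smul_eq_mul, ← map_smul, h]
  simp only [map_add, gaussE_X_mul, laplacian_apply, gradInner, pderiv_mul, mul_add]
  ring

theorem gaussE_harmonic_mul {l : ℕ} {f : MvPolynomial (Fin 3) ℝ} (hf : f ∈ harmonicHomog l)
    (q : MvPolynomial (Fin 3) ℝ) : l * gaussE (f * q) = gaussE (gradInner f q) := by
  have := gaussE_mul_homogeneous hf.1 q
  rw [(mem_harmonicHomog.1 hf).2, mul_zero, map_zero, zero_add, gradInner_comm] at this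
  rw [mul_comm f, this]

theorem gaussE_harmonic_mul_laplacian {l n : ℕ} {f q : MvPolynomial (Fin 3) ℝ}
    (hf : f ∈ harmonicHomog l) (hq : q.IsHomogeneous n) :
    ((n : ℝ) - l) * gaussE (f * q) = gaussE (f * laplacian q) := by
  rw [sub_mul, gaussE_harmonic_mul hf, gaussE_mul_homogeneous hq]; ring

theorem gaussE_harmonic_orthogonal {l m : ℕ} {f q : MvPolynomial (Fin 3) ℝ}
    (hf : f ∈ harmonicHomog l) (hq : q ∈ harmonicHomog m) (hlm : l ≠ m) :
    gaussE (f * q) = 0 := by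
  have h := gaussE_harmonic_mul_laplacian hf hq.1
  rw [(mem_harmonicHomog.1 hq).2, mul_zero, map_zero] at h
  refine (mul_eq_zero.1 h).resolve_left ?_
  exact sub_ne_zero.2 (by exact_mod_cast hlm.symm)

theorem pderiv_mem_harmonicHomog {l : ℕ} {f : MvPolynomial (Fin 3) ℝ}
    (hf : f ∈ harmonicHomog (l + 1)) (i : Fin 3) : pderiv i f ∈ harmonicHomog l := by
  refine mem_harmonicHomog.2 ⟨IsHomogeneous.pderiv hf.1, ?_⟩
  rw [laplacian_pderiv, (mem_harmonicHomog.1 hf).2, map_zero]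

theorem gaussE_harmonic_mul_of_lt {l n : ℕ} {f q : MvPolynomial (Fin 3) ℝ}
    (hf : f ∈ harmonicHomog l) (hq : q.IsHomogeneous n) (hn : n < l) :
    gaussE (f * q) = 0 := by
  induction l generalizing n f q with
  | zero => omega
  | succ l ih =>
    have h := gaussE_harmonic_mul hf q
    have hz : ∀ i, gaussE (pderiv i f * pderiv i q) = 0 := by
      intro i
      rcases Nat.eq_zero_or_pos n with rfl | hpos
      · obtain ⟨c, rfl⟩ := exists_eq_C_of_isHomogeneous_zero hq
        simp
      · exact ih (pderiv_mem_harmonicHomog hf i) hq.pderiv (by omega)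
    rw [gradInner, map_add, map_add, hz, hz, hz] at h
    refine (mul_eq_zero.1 (h.trans (by simp))).resolve_left ?_
    positivity

theorem gaussE_harmonic_sq {l : ℕ} {f : MvPolynomial (Fin 3) ℝ} (hf : f ∈ harmonicHomog l) :
    0 ≤ gaussE (f * f) ∧ (gaussE (f * f) = 0 → f = 0) := by
  induction l generalizing f with
  | zero =>
    obtain ⟨c, rfl⟩ := exists_eq_C_of_isHomogeneous_zero hf.1
    rw [← C_mul, gaussE_C]
    exact ⟨mul_self_nonneg c, fun h => by rw [mul_self_eq_zero.1 h, C_0]⟩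
  | succ l ih =>
    have h := gaussE_harmonic_mul hf f
    rw [gradInner, map_add, map_add] at h
    have h0 := ih (pderiv_mem_harmonicHomog hf 0)
    have h1 := ih (pderiv_mem_harmonicHomog hf 1)
    have h2 := ih (pderiv_mem_harmonicHomog hf 2)
    have hl : (0 : ℝ) < (l + 1 : ℕ) := by positivity
    refine ⟨?_, fun hz => ?_⟩
    · refine nonneg_of_mul_nonneg_right ?_ hl
      rw [h]
      linarith [h0.1, h1.1, h2.1]
    · rw [hz, mul_zero] at h
      have he := euler_identity hf.1
      rw [h0.2 (by linarith [h0.1, h1.1, h2.1]), h1.2 (by linarith [h0.1, h1.1, h2.1]),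
        h2.2 (by linarith [h0.1, h1.1, h2.1])] at he
      simp only [mul_zero, add_zero] at he
      exact (smul_eq_zero.1 he.symm).resolve_left hl.ne'

theorem gaussE_radiusSq_mul {n : ℕ} {p : MvPolynomial (Fin 3) ℝ} (hp : p.IsHomogeneous n) :
    gaussE (radiusSq * p) = (n + 3) * gaussE p := by
  have h : radiusSq * p = X 0 * (X 0 * p) + X 1 * (X 1 * p) + X 2 * (X 2 * p) := by
    simp only [radiusSq]; ring
  have h2 : pderiv 0 (X 0 * p) + pderiv 1 (X 1 * p) + pderiv 2 (X 2 * p)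
      = ((n : ℝ) + 3) • p := by
    rw [add_smul, ← euler_identity hp]
    simp only [pderiv_mul, pderiv_X_self, smul_eq_C_mul, map_ofNat]
    ring
  rw [h, map_add, map_add, gaussE_X_mul, gaussE_X_mul, gaussE_X_mul, ← map_add, ← map_add, h2,
    map_smul, smul_eq_mul]

/-- Every homogeneous polynomial is the sum of a harmonic one and a multiple of the squared
radius. -/
theorem exists_harmonic_add_radiusSq_mul {n : ℕ} {p : MvPolynomial (Fin 3) ℝ}
    (hp : p.IsHomogeneous (n + 2)) :
    ∃ u ∈ harmonicHomog (n + 2), ∃ v : MvPolynomial (Fin 3) ℝ, v.IsHomogeneous n ∧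
      p = u + radiusSq * v := by
  have : FiniteDimensional ℝ (homogeneousSubmodule (Fin 3) ℝ n) :=
    Module.Finite.iff_fg.2 (homogeneousSubmodule_fg _ _ n)
  have hom : ∀ q ∈ homogeneousSubmodule (Fin 3) ℝ n, (radiusSq * q).IsHomogeneous (n + 2) := by
    intro q hq
    rw [add_comm]
    exact radiusSq_isHomogeneous.mul hq
  let L : homogeneousSubmodule (Fin 3) ℝ n →ₗ[ℝ] homogeneousSubmodule (Fin 3) ℝ n :=
    (laplacian ∘ₗ LinearMap.mulLeft ℝ radiusSq).restrict fun q hq =>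
      isHomogeneous_laplacian (hom q hq)
  have hL : Function.Injective L := by
    rw [injective_iff_map_eq_zero]
    rintro ⟨q, hq⟩ h
    have hh : radiusSq * q ∈ harmonicHomog (n + 2) := ⟨hom q hq, congrArg Subtype.val h⟩
    have h0 : gaussE (radiusSq * q * (radiusSq * q)) = 0 := by
      rw [mul_left_comm, gaussE_radiusSq_mul (hh.1.mul hq),
        gaussE_harmonic_mul_of_lt hh hq (by omega), mul_zero]
    have := (mul_eq_zero.1 ((gaussE_harmonic_sq hh).2 h0)).resolve_left radiusSq_ne_zero
    exact Subtype.ext this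
  obtain ⟨⟨v, hv⟩, h⟩ := LinearMap.injective_iff_surjective.1 hL
    ⟨laplacian p, isHomogeneous_laplacian hp⟩
  have h' : laplacian (radiusSq * v) = laplacian p := congrArg Subtype.val h
  refine ⟨p - radiusSq * v, mem_harmonicHomog.2 ⟨hp.sub (hom v hv), ?_⟩, v, hv, by ring⟩
  rw [map_sub, h', sub_self]

theorem harmonic_of_isHomogeneous_of_lt_two {n : ℕ} {p : MvPolynomial (Fin 3) ℝ}
    (hp : p.IsHomogeneous n) (hn : n < 2) : p ∈ harmonicHomog n := by
  refine mem_harmonicHomog.2 ⟨hp, ?_⟩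
  have h : ∀ i, pderiv i (pderiv i p) = 0 := by
    intro i
    have h0 : (pderiv i p).IsHomogeneous 0 := by
      have := hp.pderiv (i := i)
      rwa [show n - 1 = 0 by omega] at this
    obtain ⟨c, hc⟩ := exists_eq_C_of_isHomogeneous_zero h0
    rw [hc, pderiv_C]
  rw [laplacian_apply, h, h, h, add_zero, add_zero]

theorem radiusSq_dvd_of_orthogonal_harmonic {l : ℕ} {p : MvPolynomial (Fin 3) ℝ}
    (hp : p.IsHomogeneous l) (h : ∀ f ∈ harmonicHomog l, gaussE (f * p) = 0) :
    radiusSq ∣ p := by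
  rcases lt_or_ge l 2 with hl | hl
  · have hh := harmonic_of_isHomogeneous_of_lt_two hp hl
    rw [(gaussE_harmonic_sq hh).2 (h p hh)]
    exact dvd_zero _
  · obtain ⟨n, rfl⟩ := Nat.exists_eq_add_of_le' hl
    obtain ⟨u, hu, v, hv, rfl⟩ := exists_harmonic_add_radiusSq_mul hp
    have h0 := h u hu
    rw [mul_add, map_add, mul_left_comm, gaussE_radiusSq_mul (hu.1.mul hv),
      gaussE_harmonic_mul_of_lt hu hv (by omega), mul_zero, add_zero] at h0
    rw [(gaussE_harmonic_sq hu).2 h0, zero_add]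
    exact dvd_mul_right _ _

theorem gaussE_harmonic_mul_laplacian_iterate {l : ℕ} {f : MvPolynomial (Fin 3) ℝ}
    (hf : f ∈ harmonicHomog l) (k : ℕ) {n : ℕ} {q : MvPolynomial (Fin 3) ℝ}
    (hq : q.IsHomogeneous n) (h : gaussE (f * q) = 0) :
    gaussE (f * laplacian^[k] q) = 0 := by
  induction k generalizing n q with
  | zero => exact h
  | succ k ih =>
    rw [Function.iterate_succ_apply]
    refine ih (isHomogeneous_laplacian hq) ?_
    rw [← gaussE_harmonic_mul_laplacian hf hq, h, mul_zero]

theorem gaussE_pb (f g : MvPolynomial (Fin 3) ℝ) : gaussE (pb f g) = 0 := by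
  rw [pb, map_add, map_add, gaussE_X_mul, gaussE_X_mul, gaussE_X_mul, ← map_add, ← map_add,
    ← map_zero gaussE]
  congr 1
  simp only [map_sub, pderiv_mul, pderiv_comm 1 0, pderiv_comm 2 0, pderiv_comm 2 1]
  ring

theorem pb_mul_right (f g h : MvPolynomial (Fin 3) ℝ) :
    pb f (g * h) = pb f g * h + g * pb f h := by
  simp only [pb, pderiv_mul]; ring

theorem pb_antisymm (f g : MvPolynomial (Fin 3) ℝ) : pb f g = -pb g f := by
  simp only [pb]; ring

theorem gaussE_pb_mul (f g h : MvPolynomial (Fin 3) ℝ) :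
    gaussE (pb f g * h) = gaussE (f * pb g h) := by
  have := gaussE_pb g (f * h)
  rw [pb_mul_right, pb_antisymm g f, neg_mul, map_add, map_neg] at this
  linarith

theorem isHomogeneous_pb {l m : ℕ} {f g : MvPolynomial (Fin 3) ℝ} (hf : f.IsHomogeneous l)
    (hg : g.IsHomogeneous m) : (pb f g).IsHomogeneous (1 + (l - 1 + (m - 1))) := by
  have h : ∀ i j k : Fin 3, (X i * (pderiv j f * pderiv k g - pderiv k f * pderiv j g)).IsHomogeneous
      (1 + (l - 1 + (m - 1))) := fun i j k =>
    (isHomogeneous_X _ i).mul ((hf.pderiv.mul hg.pderiv).sub (hf.pderiv.mul hg.pderiv))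
  exact ((h 0 1 2).add (h 1 2 0)).add (h 2 0 1)

/-- The real and imaginary parts of `(X₀ + i X₁) ^ n`. -/
def planarPow : ℕ → MvPolynomial (Fin 3) ℝ × MvPolynomial (Fin 3) ℝ
  | 0 => (1, 0)
  | n + 1 => (X 0 * (planarPow n).1 - X 1 * (planarPow n).2,
      X 0 * (planarPow n).2 + X 1 * (planarPow n).1)

theorem isHomogeneous_planarPow (n : ℕ) :
    (planarPow n).1.IsHomogeneous n ∧ (planarPow n).2.IsHomogeneous n := by
  induction n with
  | zero => exact ⟨isHomogeneous_one _ _, isHomogeneous_zero _ _ _⟩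
  | succ n ih =>
    rw [add_comm n 1]
    rw [show planarPow (1 + n) = planarPow (n + 1) by rw [add_comm]]
    exact ⟨((isHomogeneous_X _ 0).mul ih.1).sub ((isHomogeneous_X _ 1).mul ih.2),
      ((isHomogeneous_X _ 0).mul ih.2).add ((isHomogeneous_X _ 1).mul ih.1)⟩

theorem pderiv_two_planarPow (n : ℕ) :
    pderiv 2 (planarPow n).1 = 0 ∧ pderiv 2 (planarPow n).2 = 0 := by
  induction n with
  | zero => simp [planarPow]
  | succ n ih => simp [planarPow, ih.1, ih.2, pderiv_X]

theorem pderiv_planarPow (n : ℕ) :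
    (pderiv 0 (planarPow n).1 = n * (planarPow (n - 1)).1 ∧
      pderiv 1 (planarPow n).1 = -(n * (planarPow (n - 1)).2)) ∧
    (pderiv 0 (planarPow n).2 = n * (planarPow (n - 1)).2 ∧
      pderiv 1 (planarPow n).2 = n * (planarPow (n - 1)).1) := by
  induction n with
  | zero => simp [planarPow]
  | succ n ih =>
    obtain ⟨⟨h1, h2⟩, h3, h4⟩ := ih
    have e1 : (n : MvPolynomial (Fin 3) ℝ) * (X 0 * (planarPow (n - 1)).1
        - X 1 * (planarPow (n - 1)).2) = (n : MvPolynomial (Fin 3) ℝ) * (planarPow n).1 := by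
      cases n <;> simp [planarPow]
    have e2 : (n : MvPolynomial (Fin 3) ℝ) * (X 0 * (planarPow (n - 1)).2
        + X 1 * (planarPow (n - 1)).1) = (n : MvPolynomial (Fin 3) ℝ) * (planarPow n).2 := by
      cases n <;> simp [planarPow]
    simp only [planarPow, map_sub, map_add, pderiv_mul, pderiv_X_self, h1, h2, h3, h4,
      pderiv_X_of_ne (show (1 : Fin 3) ≠ 0 by decide),
      pderiv_X_of_ne (show (0 : Fin 3) ≠ 1 by decide), Nat.add_sub_cancel, Nat.cast_add,
      Nat.cast_one]
    refine ⟨⟨?_, ?_⟩, ?_, ?_⟩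
    · linear_combination e1
    · linear_combination -e2
    · linear_combination e2
    · linear_combination e1

theorem planarPow_mem_harmonicHomog (n : ℕ) :
    (planarPow n).1 ∈ harmonicHomog n ∧ (planarPow n).2 ∈ harmonicHomog n := by
  constructor
  · refine mem_harmonicHomog.2 ⟨(isHomogeneous_planarPow n).1, ?_⟩
    simp [laplacian_apply, pderiv_planarPow, pderiv_two_planarPow]
  · refine mem_harmonicHomog.2 ⟨(isHomogeneous_planarPow n).2, ?_⟩
    simp [laplacian_apply, pderiv_planarPow, pderiv_two_planarPow]

/-- The real part of `(X₀ + i X₁) ^ a (X₀ - i X₁) ^ b`. -/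
def planarRe (a b : ℕ) : MvPolynomial (Fin 3) ℝ :=
  (planarPow a).1 * (planarPow b).1 + (planarPow a).2 * (planarPow b).2

theorem laplacian_X_two_mul_planarRe (a b : ℕ) :
    laplacian (X 2 * planarRe a b) = (4 * a * b : ℝ) • (X 2 * planarRe (a - 1) (b - 1)) := by
  have ha := planarPow_mem_harmonicHomog a
  have hb := planarPow_mem_harmonicHomog b
  have hX : laplacian (X 2) = 0 := by simp [laplacian_apply, pderiv_X]
  rw [laplacian_mul, hX, planarRe, map_add, laplacian_mul, laplacian_mul,
    (mem_harmonicHomog.1 ha.1).2, (mem_harmonicHomog.1 hb.1).2,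
    (mem_harmonicHomog.1 ha.2).2, (mem_harmonicHomog.1 hb.2).2]
  simp only [gradInner, map_add, pderiv_mul, pderiv_planarPow, pderiv_two_planarPow, pderiv_X_self,
    pderiv_X_of_ne (show (2 : Fin 3) ≠ 0 by decide), pderiv_X_of_ne (show (2 : Fin 3) ≠ 1 by decide),
    smul_eq_C_mul, C_mul, map_ofNat, map_natCast, planarRe]
  ring

theorem laplacian_iterate_X_two_mul_planarRe (k : ℕ) {a b : ℕ} (ha : k ≤ a) (hb : k ≤ b) :
    ∃ c : ℝ, c ≠ 0 ∧
      laplacian^[k] (X 2 * planarRe a b) = c • (X 2 * planarRe (a - k) (b - k)) := by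
  induction k with
  | zero => exact ⟨1, one_ne_zero, by simp⟩
  | succ k ih =>
    obtain ⟨c, hc, h⟩ := ih (by omega) (by omega)
    refine ⟨c * (4 * (a - k : ℕ) * (b - k : ℕ)), ?_, ?_⟩
    · have h1 : ((a - k : ℕ) : ℝ) ≠ 0 := by exact_mod_cast (by omega : a - k ≠ 0)
      have h2 : ((b - k : ℕ) : ℝ) ≠ 0 := by exact_mod_cast (by omega : b - k ≠ 0)
      positivity
    · rw [Function.iterate_succ_apply', h, map_smul, laplacian_X_two_mul_planarRe, smul_smul,
        Nat.sub_sub, Nat.sub_sub]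

theorem pb_planarPow (l d : ℕ) :
    pb (planarPow l).1 (planarPow d).2 = (l * d : ℝ) • (X 2 * planarRe (l - 1) (d - 1)) := by
  simp only [pb, pderiv_planarPow, pderiv_two_planarPow, planarRe, smul_eq_C_mul, C_mul,
    map_natCast]
  ring

/-- A complex zero of the squared radius. -/
def conePoint : Fin 3 → ℂ := ![-3, -5 * Complex.I, 4]

theorem aeval_conePoint_radiusSq : aeval conePoint radiusSq = 0 := by
  simp [radiusSq, conePoint, mul_pow]
  norm_num

theorem aeval_conePoint_planarPow (n : ℕ) :
    aeval conePoint (planarPow n).1 + Complex.I * aeval conePoint (planarPow n).2 = 2 ^ n ∧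
    aeval conePoint (planarPow n).1 - Complex.I * aeval conePoint (planarPow n).2 = (-8) ^ n := by
  induction n with
  | zero => simp [planarPow]
  | succ n ih =>
    rw [pow_succ, pow_succ, ← ih.1, ← ih.2]
    have h0 : conePoint 0 = -3 := rfl
    have h1 : conePoint 1 = -5 * Complex.I := rfl
    simp only [planarPow, map_sub, map_add, map_mul, aeval_X, h0, h1]
    constructor
    · linear_combination (-5 * aeval conePoint (planarPow n).1) * Complex.I_sq
    · linear_combination (5 * aeval conePoint (planarPow n).1) * Complex.I_sq

theorem aeval_conePoint_planarRe_ne_zero (a b : ℕ) : aeval conePoint (planarRe a b) ≠ 0 := by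
  have ha := aeval_conePoint_planarPow a
  have hb := aeval_conePoint_planarPow b
  intro h
  have h1 : (2 : ℂ) ^ a * (-8) ^ b + (-8) ^ a * 2 ^ b = 0 := by
    rw [← ha.1, ← ha.2, ← hb.1, ← hb.2]
    simp only [planarRe, map_add, map_mul] at h
    linear_combination 2 * h - 2 * aeval conePoint (planarPow a).2
      * aeval conePoint (planarPow b).2 * Complex.I_sq
  rw [show (-8 : ℂ) = 2 * (-4) by norm_num, mul_pow, mul_pow] at h1
  have h2 : (-4 : ℂ) ^ b = -(-4) ^ a := by
    have : (2 : ℂ) ^ a * 2 ^ b * ((-4) ^ b + (-4) ^ a) = 0 := by linear_combination h1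
    simpa [eq_neg_iff_add_eq_zero] using this
  have h3 : (4 : ℝ) ^ b = 4 ^ a := by simpa using congrArg norm h2
  have h4 : b = a := pow_right_injective₀ (by norm_num : (0 : ℝ) < 4) (by norm_num) h3
  rw [h4, eq_neg_iff_add_eq_zero, ← two_mul] at h2
  simp at h2

theorem exists_gaussE_pb_mul_ne_zero {l k : ℕ} (hk : k < l) :
    ∃ f ∈ harmonicHomog l,
      gaussE (pb f (planarPow l).1 * (planarPow (2 * k + 1)).2) ≠ 0 := by
  by_contra! h
  simp only [gaussE_pb_mul] at h
  set q := pb (planarPow l).1 (planarPow (2 * k + 1)).2 with hq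
  have hqh := isHomogeneous_pb (isHomogeneous_planarPow l).1 (isHomogeneous_planarPow (2 * k + 1)).2
  rw [← hq] at hqh
  obtain ⟨c, hc, hcq⟩ := laplacian_iterate_X_two_mul_planarRe k (a := l - 1) (b := 2 * k)
    (by omega) (by omega)
  have hlap : laplacian^[k] q
      = (l * (2 * k + 1 : ℕ) * c : ℝ) • (X 2 * planarRe (l - 1 - k) (2 * k - k)) := by
    rw [hq, pb_planarPow, ← Module.End.pow_apply, map_smul, Module.End.pow_apply,
      Nat.add_sub_cancel, hcq, smul_smul]
  have hom : (laplacian^[k] q).IsHomogeneous l := by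
    have h1 := ((isHomogeneous_X ℝ (2 : Fin 3)).mul
      (((isHomogeneous_planarPow (l - 1 - k)).1.mul (isHomogeneous_planarPow (2 * k - k)).1).add
      ((isHomogeneous_planarPow (l - 1 - k)).2.mul (isHomogeneous_planarPow (2 * k - k)).2))).C_mul
      (l * (2 * k + 1 : ℕ) * c : ℝ)
    rw [hlap, smul_eq_C_mul]
    rwa [show 1 + (l - 1 - k + (2 * k - k)) = l by omega] at h1
  obtain ⟨v, hv⟩ := radiusSq_dvd_of_orthogonal_harmonic hom fun f hf =>
    gaussE_harmonic_mul_laplacian_iterate hf k hqh (h f hf)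
  have h0 := congrArg (aeval conePoint) (hlap.symm.trans hv)
  rw [map_mul, aeval_conePoint_radiusSq, zero_mul, map_smul, map_mul, aeval_X] at h0
  have hl : (l : ℝ) ≠ 0 := by exact_mod_cast (by omega : l ≠ 0)
  have hd : ((2 * k + 1 : ℕ) : ℝ) ≠ 0 := by positivity
  refine (smul_ne_zero (mul_ne_zero (mul_ne_zero hl hd) hc) (mul_ne_zero ?_
    (aeval_conePoint_planarRe_ne_zero _ _))) h0
  simp [conePoint]

/-- The mean value of a polynomial over the sphere of radius `s`, as a combination of the Gaussian
expectations of its homogeneous components. -/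
def sphereMean (s : ℝ) : MvPolynomial (Fin 3) ℝ →ₗ[ℝ] ℝ :=
  (basisMonomials (Fin 3) ℝ).constr ℝ fun a =>
    s ^ a.degree / (a.degree + 1).doubleFactorial * gaussE (monomial a 1)

theorem sphereMean_of_isHomogeneous (s : ℝ) {n : ℕ} {p : MvPolynomial (Fin 3) ℝ}
    (hp : p.IsHomogeneous n) :
    sphereMean s p = s ^ n / (n + 1).doubleFactorial * gaussE p := by
  conv_lhs => rw [p.as_sum]
  conv_rhs => rw [p.as_sum]
  rw [map_sum, map_sum, Finset.mul_sum]
  refine Finset.sum_congr rfl fun a ha => ?_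
  have hd : a.degree = n := by
    by_contra h
    exact mem_support_iff.1 ha (hp.coeff_eq_zero h)
  have h : monomial a (coeff a p) = coeff a p • basisMonomials (Fin 3) ℝ a := by
    simp [smul_monomial]
  rw [h, map_smul, map_smul, sphereMean, Module.Basis.constr_basis, hd, coe_basisMonomials,
    smul_eq_mul, smul_eq_mul]
  ring

theorem sphereMean_radiusSq_mul (s : ℝ) (p : MvPolynomial (Fin 3) ℝ) :
    sphereMean s (radiusSq * p) = s ^ 2 * sphereMean s p := by
  induction p using induction_on' with
  | monomial a c =>
    have ha : (monomial a c).IsHomogeneous a.degree := isHomogeneous_monomial c rfl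
    have hr := radiusSq_isHomogeneous.mul ha
    rw [add_comm] at hr
    rw [sphereMean_of_isHomogeneous s ha, sphereMean_of_isHomogeneous s hr,
      gaussE_radiusSq_mul ha, show a.degree + 2 + 1 = (a.degree + 1) + 2 by ring,
      Nat.doubleFactorial_add_two]
    have h1 : ((a.degree + 1).doubleFactorial : ℝ) ≠ 0 := by
      exact_mod_cast (Nat.doubleFactorial_pos _).ne'
    have h2 : (a.degree : ℝ) + 1 + 2 ≠ 0 := by positivity
    push_cast
    field_simp
    ring
  | add p q hp hq => simp only [mul_add, map_add, hp, hq]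

theorem sphereMean_eq_zero_of_mem_sphereIdeal (s : ℝ) {p : MvPolynomial (Fin 3) ℝ}
    (hp : p ∈ sphereIdeal s) : sphereMean s p = 0 := by
  obtain ⟨c, rfl⟩ := Ideal.mem_span_singleton'.1 hp
  have h : c * (X 0 ^ 2 + X 1 ^ 2 + X 2 ^ 2 - C (s ^ 2)) = radiusSq * c - s ^ 2 • c := by
    rw [radiusSq, smul_eq_C_mul]; ring
  rw [h, map_sub, sphereMean_radiusSq_mul, map_smul, smul_eq_mul, sub_self]

theorem toSphere_mem_Hsph (s : ℝ) {l : ℕ} {f : MvPolynomial (Fin 3) ℝ}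
    (hf : f ∈ harmonicHomog l) : toSphere s f ∈ Hsph s l :=
  ⟨f, hf, rfl⟩

theorem toSphere_smul (s c : ℝ) (p : MvPolynomial (Fin 3) ℝ) :
    toSphere s (c • p) = c • toSphere s p := rfl

theorem toSphere_radiusSq (s : ℝ) : toSphere s radiusSq = s ^ 2 • 1 := by
  rw [← map_one (toSphere s), ← toSphere_smul, toSphere, Ideal.Quotient.eq, smul_eq_C_mul, mul_one]
  exact Ideal.subset_span rfl

theorem sphereMean_mul_eq_zero (s : ℝ) {d : ℕ} {h p : MvPolynomial (Fin 3) ℝ}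
    (hh : h ∈ harmonicHomog d)
    (hp : toSphere s p ∈ ⨆ (l : ℕ) (_ : l ≠ d), Hsph s l) : sphereMean s (p * h) = 0 := by
  let T : MvPolynomial (Fin 3) ℝ →ₗ[ℝ] ℝ := sphereMean s ∘ₗ LinearMap.mulRight ℝ h
  have hle : (⨆ (l : ℕ) (_ : l ≠ d), Hsph s l)
      ≤ (LinearMap.ker T).map (Ideal.Quotient.mkₐ ℝ (sphereIdeal s)).toLinearMap := by
    refine iSup₂_le fun l hl => Submodule.map_mono fun f hf => ?_
    change sphereMean s (f * h) = 0
    rw [sphereMean_of_isHomogeneous s (hf.1.mul hh.1), gaussE_harmonic_orthogonal hf hh hl,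
      mul_zero]
  obtain ⟨p', hp', he⟩ := hle hp
  have hmem : p - p' ∈ sphereIdeal s := Ideal.Quotient.eq.1 he.symm
  have h0 := sphereMean_eq_zero_of_mem_sphereIdeal s (Ideal.mul_mem_right h _ hmem)
  have h1 : sphereMean s (p' * h) = 0 := hp'
  rwa [sub_mul, map_sub, h1, sub_zero] at h0

theorem toSphere_mem_iSup_of_isHomogeneous (s : ℝ) {n : ℕ} {p : MvPolynomial (Fin 3) ℝ}
    (hp : p.IsHomogeneous n) : toSphere s p ∈ ⨆ l, Hsph s l := by
  induction n using Nat.strong_induction_on generalizing p with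
  | _ n ih =>
    rcases lt_or_ge n 2 with hn | hn
    · exact Submodule.mem_iSup_of_mem n
        (toSphere_mem_Hsph s (harmonic_of_isHomogeneous_of_lt_two hp hn))
    · obtain ⟨m, rfl⟩ := Nat.exists_eq_add_of_le' hn
      obtain ⟨u, hu, v, hv, rfl⟩ := exists_harmonic_add_radiusSq_mul hp
      rw [map_add, map_mul, toSphere_radiusSq, smul_mul_assoc, one_mul]
      exact add_mem (Submodule.mem_iSup_of_mem _ (toSphere_mem_Hsph s hu))
        (Submodule.smul_mem _ _ (ih m (by omega) hv))

theorem mem_iSup_Hsph (s : ℝ) (x : SpherePoly s) : x ∈ ⨆ l, Hsph s l := by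
  obtain ⟨p, rfl⟩ := Ideal.Quotient.mk_surjective x
  change toSphere s p ∈ _
  rw [← sum_homogeneousComponent p, map_sum]
  exact sum_mem fun n _ =>
    toSphere_mem_iSup_of_isHomogeneous s (homogeneousComponent_isHomogeneous n p)

theorem hcomp_ne_zero (s : ℝ) {d : ℕ} {x : SpherePoly s}
    (hx : x ∉ ⨆ (l : ℕ) (_ : l ≠ d), Hsph s l) : hcomp s d x ≠ 0 := by
  have h : ∃ q, q ∈ Hsph s d ∧ x - q ∈ ⨆ (l : ℕ) (_ : l ≠ d), Hsph s l := by
    have hm := mem_iSup_Hsph s x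
    rw [iSup_split_single (Hsph s) d, Submodule.mem_sup] at hm
    obtain ⟨q, hq, r, hr, rfl⟩ := hm
    exact ⟨q, hq, by rwa [add_sub_cancel_left]⟩
  rw [hcomp, dif_pos h]
  intro h0
  have := h.choose_spec.2
  rw [h0, sub_zero] at this
  exact hx this

theorem pb_mem_sphereIdeal (s : ℝ) {p : MvPolynomial (Fin 3) ℝ} (hp : p ∈ sphereIdeal s)
    (f : MvPolynomial (Fin 3) ℝ) : pb f p ∈ sphereIdeal s := by
  obtain ⟨c, rfl⟩ := Ideal.mem_span_singleton'.1 hp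
  have h : pb f (X 0 ^ 2 + X 1 ^ 2 + X 2 ^ 2 - C (s ^ 2)) = 0 := by
    simp only [pb, map_sub, map_add, pderiv_pow, pderiv_X, pderiv_C, Pi.single_apply]
    simp
    ring
  rw [pb_mul_right, h, mul_zero, add_zero]
  exact Ideal.mul_mem_left _ _ (Ideal.subset_span rfl)

theorem pbS_toSphere (s : ℝ) (f g : MvPolynomial (Fin 3) ℝ) :
    pbS s (toSphere s f) (toSphere s g) = toSphere s (pb f g) := by
  have hrep : ∀ p, rep s (toSphere s p) - p ∈ sphereIdeal s := fun p =>
    Ideal.Quotient.eq.1 (Ideal.Quotient.mk_surjective (I := sphereIdeal s) (toSphere s p)).choose_spec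
  refine Ideal.Quotient.eq.2 ?_
  set f' := rep s (toSphere s f)
  set g' := rep s (toSphere s g)
  have h : pb f' g' - pb f g = pb f' (g' - g) - pb g (f' - f) := by
    simp only [pb, map_sub]; ring
  rw [h]
  exact sub_mem (pb_mem_sphereIdeal s (hrep g) _) (pb_mem_sphereIdeal s (hrep f) _)

theorem pb_add_left (f f' g : MvPolynomial (Fin 3) ℝ) : pb (f + f') g = pb f g + pb f' g := by
  simp only [pb, map_add]; ring

theorem pb_smul_left (c : ℝ) (f g : MvPolynomial (Fin 3) ℝ) : pb (c • f) g = c • pb f g := by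
  simp only [pb, smul_eq_C_mul, pderiv_C_mul]; ring

/-- The linear functional pairing a bracket with fixed right entry `g` against `h`. -/
def bracketPairing (g h : MvPolynomial (Fin 3) ℝ) : Module.Dual ℝ (MvPolynomial (Fin 3) ℝ) where
  toFun f := gaussE (pb f g * h)
  map_add' a b := by rw [pb_add_left, add_mul, map_add]
  map_smul' c a := by rw [pb_smul_left, smul_mul_assoc, map_smul, RingHom.id_apply]

theorem bracketPairing_apply (f g h : MvPolynomial (Fin 3) ℝ) :
    bracketPairing g h f = gaussE (pb f g * h) := rfl

/-- For every `l` there is one pair of spherical harmonics of degree `l` whose bracket has nonzero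
harmonic components in all odd degrees up to `2 * l - 1`. -/
theorem exists_forall_odd_hcomp_ne_zero (s : ℝ) (hs : 0 < s) (l : ℕ) :
    ∃ p ∈ Hsph s l, ∃ q ∈ Hsph s l, ∀ d : ℕ, Odd d → d ≤ 2 * l - 1 →
      hcomp s d (pbS s p q) ≠ 0 := by
  obtain ⟨f, hf, hne⟩ := Module.Dual.exists_forall_mem_ne_zero_of_forall_exists (harmonicHomog l)
    (fun k : Fin l => bracketPairing (planarPow l).1 (planarPow (2 * k + 1)).2)
    fun k => by
      obtain ⟨f, hf, hne⟩ := exists_gaussE_pb_mul_ne_zero k.2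
      exact ⟨f, hf, by rwa [bracketPairing_apply]⟩
  have hg := (planarPow_mem_harmonicHomog l).1
  refine ⟨_, toSphere_mem_Hsph s hf, _, toSphere_mem_Hsph s hg, ?_⟩
  rintro d ⟨k, rfl⟩ hd
  have hh := (planarPow_mem_harmonicHomog (2 * k + 1)).2
  rw [pbS_toSphere]
  refine hcomp_ne_zero s fun hmem => ?_
  have h0 := sphereMean_mul_eq_zero s hh hmem
  rw [sphereMean_of_isHomogeneous s ((isHomogeneous_pb hf.1 hg.1).mul hh.1)] at h0
  have hk := hne ⟨k, by omega⟩
  rw [bracketPairing_apply] at hk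
  refine mul_ne_zero (div_ne_zero (pow_pos hs _).ne' ?_) hk h0
  exact_mod_cast (Nat.doubleFactorial_pos _).ne'

/-- Nonvanishing of harmonic components of Poisson brackets of spherical harmonics
(real form of Lemma 2.5): (i) for every `l ≥ 1` there are `p, q ∈ H_l` whose bracket has
nonzero degree-`(2l-1)` harmonic component; (ii) for every odd `l ≥ 5` there are
`p, q ∈ H_l` whose bracket has nonzero degree-`d` harmonic component for every odd `d`
with `l - 2 ≤ d ≤ 2l - 1`. -/
theorem bracket_components_ne_zero (s : ℝ) (hs : 0 < s) :
    (∀ l : ℕ, 1 ≤ l → ∃ p ∈ Hsph s l, ∃ q ∈ Hsph s l,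
      hcomp s (2 * l - 1) (pbS s p q) ≠ 0) ∧
    (∀ l : ℕ, Odd l → 5 ≤ l → ∃ p ∈ Hsph s l, ∃ q ∈ Hsph s l,
      ∀ d : ℕ, Odd d → l - 2 ≤ d → d ≤ 2 * l - 1 →
        hcomp s d (pbS s p q) ≠ 0) := by
  refine ⟨fun l hl => ?_, fun l _ _ => ?_⟩
  · obtain ⟨p, hp, q, hq, h⟩ := exists_forall_odd_hcomp_ne_zero s hs l
    exact ⟨p, hp, q, hq, h _ ⟨l - 1, by omega⟩ le_rfl⟩
  · obtain ⟨p, hp, q, hq, h⟩ := exists_forall_odd_hcomp_ne_zero s hs l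
    exact ⟨p, hp, q, hq, fun d hd _ hle => h d hd hle⟩

end
end
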